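/- arXiv:1109.3304 — 2 statements merged into one kernel-verified Lean document; each statement's English description precedes it below -/
import Mathlib

section
/- Let λ>0 and 1=p≤q<∞, and let v be a non-negative measurable weight on (0,∞). Denote v̄₀(t)=ess sup_{0<x<t} v(x) and B̄(t)=t^{−λ/q} v̄₀(t). Then the Laplace-type operator 𝓛 is compact from L^1 to L^q if and only if ess sup_{t>0} B̄(t) < ∞, lim_{t→0⁺} B̄(t)=0 and lim_{t→∞} B̄(t)=0. -/
open MeasureTheory Set Filter Topology
open scoped ENNReal NNReal

noncomputable section

/-- The Laplace-type operator `𝓛f(x) = ∫_0^∞ e^{-x y^λ} f(y) v(y) dy`. -/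
def Lap (lam : ℝ) (v f : ℝ → ℝ) : ℝ → ℝ :=
  fun x => ∫ y in Ioi (0:ℝ), Real.exp (-(x * y ^ lam)) * f y * v y

/-- `(∫_0^∞ |g|^r)^{1/r}`, the `L^r(0,∞)` (quasi-)norm. -/
def eN (r : ℝ) (g : ℝ → ℝ) : ℝ≥0∞ :=
  (∫⁻ x in Ioi (0:ℝ), ENNReal.ofReal |g x| ^ r) ^ (1/r)

/-- Compactness of the Laplace-type operator from `L^p` to `L^q` (`q ≥ 1`): the image of the
closed unit ball of `L^p` is relatively compact in the complete space `L^q`; equivalently,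
every sequence of the unit ball has a subsequence whose image is Cauchy in the `L^q` norm. -/
def LapCompact (lam p q : ℝ) (v : ℝ → ℝ) : Prop :=
  ∀ f : ℕ → ℝ → ℝ, (∀ n, Measurable (f n)) → (∀ n, eN p (f n) ≤ 1) →
    ∃ φ : ℕ → ℕ, StrictMono φ ∧
      ∀ ε : ℝ, 0 < ε → ∃ N : ℕ, ∀ m, N ≤ m → ∀ n, N ≤ n →
        eN q (fun x => Lap lam v (f (φ m)) x - Lap lam v (f (φ n)) x) < ENNReal.ofReal ε

/-- The transform `x ↦ ∫_0^∞ e^{-x y^λ} g(y) dy` of an unweighted density `g`. -/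
def lapTransform (lam : ℝ) (g : ℝ → ℝ) (x : ℝ) : ℝ :=
  ∫ y in Ioi (0:ℝ), Real.exp (-(x * y ^ lam)) * g y

lemma Lap_eq_lapTransform (lam : ℝ) (v f : ℝ → ℝ) :
    Lap lam v f = lapTransform lam (fun y => f y * v y) := by
  funext x
  simp only [Lap, lapTransform, mul_assoc]

lemma eN_eq_eLpNorm {r : ℝ} (hr : 0 < r) (g : ℝ → ℝ) :
    eN r g = eLpNorm g (ENNReal.ofReal r) (volume.restrict (Ioi 0)) := by
  rw [eLpNorm_eq_lintegral_rpow_enorm_toReal (by simpa using hr) ENNReal.ofReal_ne_top,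
    ENNReal.toReal_ofReal hr.le]
  simp only [eN, Real.enorm_eq_ofReal_abs]

lemma measurable_lapKernel (lam : ℝ) :
    Measurable (fun p : ℝ × ℝ => Real.exp (-(p.1 * p.2 ^ lam))) := by
  fun_prop

lemma measurable_lapTransform (lam : ℝ) {g : ℝ → ℝ} (hg : Measurable g) :
    Measurable (lapTransform lam g) := by
  have h : StronglyMeasurable (fun p : ℝ × ℝ => Real.exp (-(p.1 * p.2 ^ lam)) * g p.2) :=
    ((measurable_lapKernel lam).mul (hg.comp measurable_snd)).stronglyMeasurable
  exact h.integral_prod_right.measurable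

lemma lintegral_exp_rpow {q s : ℝ} (hq : 0 < q) (hs : 0 < s) :
    ∫⁻ x in Ioi (0:ℝ), ENNReal.ofReal (Real.exp (-(x * s))) ^ q = ENNReal.ofReal (1 / (q * s)) := by
  have hneg : -(q * s) < 0 := by have := mul_pos hq hs; linarith
  have h1 : ∀ x : ℝ, ENNReal.ofReal (Real.exp (-(x * s))) ^ q
      = ENNReal.ofReal (Real.exp (-(q * s) * x)) := by
    intro x
    rw [ENNReal.ofReal_rpow_of_pos (Real.exp_pos _), ← Real.exp_mul]
    congr 2
    ring
  simp_rw [h1]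
  rw [← ofReal_integral_eq_lintegral_ofReal (integrableOn_exp_mul_Ioi hneg 0)
    (Eventually.of_forall fun x => (Real.exp_pos _).le), integral_exp_mul_Ioi hneg]
  simp

/-- Minkowski-type bound in the form of an inequality for nonnegative integrals. -/
lemma lintegral_rpow_lintegral_exp_mul_le {lam q : ℝ} (hq : 1 ≤ q) {G : ℝ → ℝ≥0∞}
    (hG : Measurable G) :
    ∫⁻ x in Ioi (0:ℝ), (∫⁻ y in Ioi (0:ℝ), ENNReal.ofReal (Real.exp (-(x * y ^ lam))) * G y) ^ q
      ≤ (∫⁻ y in Ioi (0:ℝ), ENNReal.ofReal (y ^ (-(lam / q))) * G y) ^ q := by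
  have hq0 : 0 < q := by linarith
  set μ : Measure ℝ := volume.restrict (Ioi (0:ℝ)) with hμ
  set h : ℝ → ℝ≥0∞ := fun y => ENNReal.ofReal (y ^ (-(lam / q))) * G y with hh
  have hhm : Measurable h := by fun_prop
  set N := ∫⁻ y, h y ∂μ with hN
  set ν := μ.withDensity h with hν
  have hνu : ν univ = N := by simp [hν, hN]
  let K : ℝ → ℝ → ℝ≥0∞ := fun x y =>
    ENNReal.ofReal (Real.exp (-(x * y ^ lam))) * ENNReal.ofReal (y ^ (lam / q))
  have hKm : Measurable (Function.uncurry K) := by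
    simp only [K, Function.uncurry_def]
    fun_prop
  have hKx : ∀ x, Measurable (K x) := fun x => hKm.comp measurable_prodMk_left
  have hpos : ∀ᵐ y ∂μ, 0 < y := ae_restrict_mem measurableSet_Ioi
  have hKh : ∀ x, ∫⁻ y, ENNReal.ofReal (Real.exp (-(x * y ^ lam))) * G y ∂μ = ∫⁻ y, K x y ∂ν := by
    intro x
    rw [hν, lintegral_withDensity_eq_lintegral_mul _ hhm (hKx x)]
    refine lintegral_congr_ae ?_
    filter_upwards [hpos] with y hy
    have : ENNReal.ofReal (y ^ (-(lam / q))) * ENNReal.ofReal (y ^ (lam / q)) = 1 := by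
      rw [← ENNReal.ofReal_mul (by positivity), ← Real.rpow_add hy]
      simp
    simp only [Pi.mul_apply, hh, K]
    calc _ = ENNReal.ofReal (Real.exp (-(x * y ^ lam))) * G y
          * (ENNReal.ofReal (y ^ (-(lam / q))) * ENNReal.ofReal (y ^ (lam / q))) := by
            rw [this, mul_one]
      _ = _ := by ring
  have hJ : ∀ x, (∫⁻ y, K x y ∂ν) ^ q ≤ (∫⁻ y, K x y ^ q ∂ν) * N ^ (q - 1) := by
    intro x
    have := eLpNorm_le_eLpNorm_mul_rpow_measure_univ (μ := ν) (f := K x) (p := 1)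
      (q := ENNReal.ofReal q) (by simpa using hq) (hKx x).aestronglyMeasurable
    rw [eLpNorm_eq_lintegral_rpow_enorm_toReal (by simpa using hq0) ENNReal.ofReal_ne_top,
      ENNReal.toReal_ofReal hq0.le, eLpNorm_one_eq_lintegral_enorm, hνu] at this
    simp only [enorm_eq_self, ENNReal.toReal_one] at this
    calc (∫⁻ y, K x y ∂ν) ^ q
        ≤ ((∫⁻ y, K x y ^ q ∂ν) ^ (1 / q) * N ^ (1 / 1 - 1 / q)) ^ q := by gcongr
      _ = _ := by
        rw [ENNReal.mul_rpow_of_nonneg _ _ hq0.le, ← ENNReal.rpow_mul, ← ENNReal.rpow_mul]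
        congr 2
        · field_simp
          simp
        · field_simp
  have hT : ∫⁻ x, ∫⁻ y, K x y ^ q ∂ν ∂μ ≤ N := by
    have h1 : ∀ x, ∫⁻ y, K x y ^ q ∂ν = ∫⁻ y, h y * K x y ^ q ∂μ := by
      intro x
      rw [hν, lintegral_withDensity_eq_lintegral_mul _ hhm ((hKx x).pow_const q)]
      rfl
    simp_rw [h1]
    rw [lintegral_lintegral_swap]
    · refine lintegral_mono_ae ?_
      filter_upwards [hpos] with y hy
      have h2 : ∀ x, h y * K x y ^ q
          = h y * ENNReal.ofReal (y ^ lam) * ENNReal.ofReal (Real.exp (-(x * y ^ lam))) ^ q := by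
        intro x
        simp only [K]
        rw [ENNReal.mul_rpow_of_nonneg _ _ hq0.le, ENNReal.ofReal_rpow_of_pos (x := y ^ (lam / q))
          (by positivity), ← Real.rpow_mul hy.le]
        rw [div_mul_cancel₀ _ hq0.ne']
        ring
      simp_rw [h2]
      rw [lintegral_const_mul _ (by fun_prop), hμ,
        lintegral_exp_rpow hq0 (Real.rpow_pos_of_pos hy _), mul_assoc,
        ← ENNReal.ofReal_mul (by positivity)]
      have h3 : y ^ lam * (1 / (q * y ^ lam)) = 1 / q := by
        have := (Real.rpow_pos_of_pos hy lam).ne'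
        field_simp
      rw [h3]
      refine mul_le_of_le_one_right' ?_
      rw [ENNReal.ofReal_le_one, div_le_one hq0]
      exact hq
    · refine Measurable.aemeasurable ?_
      exact (hhm.comp measurable_snd).mul (hKm.pow_const q)
  calc _ = ∫⁻ x, (∫⁻ y, K x y ∂ν) ^ q ∂μ := by simp_rw [hKh]
    _ ≤ ∫⁻ x, (∫⁻ y, K x y ^ q ∂ν) * N ^ (q - 1) ∂μ := lintegral_mono hJ
    _ = (∫⁻ x, ∫⁻ y, K x y ^ q ∂ν ∂μ) * N ^ (q - 1) := by
      rw [lintegral_mul_const]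
      have : SFinite ν := by rw [hν]; infer_instance
      exact (hKm.pow_const q).lintegral_prod_right'
    _ ≤ N * N ^ (q - 1) := by gcongr
    _ = N ^ q := by
      nth_rewrite 1 [← ENNReal.rpow_one N]
      rw [← ENNReal.rpow_add_of_nonneg _ _ zero_le_one (by linarith)]
      congr 1
      ring

lemma enorm_exp_mul (a b : ℝ) : ‖Real.exp a * b‖ₑ = ENNReal.ofReal (Real.exp a) * ‖b‖ₑ := by
  rw [enorm_mul, Real.enorm_eq_ofReal (Real.exp_pos _).le]

lemma eLpNorm_lapTransform_le {lam q : ℝ} (hq : 1 ≤ q) {g : ℝ → ℝ} (hg : Measurable g) :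
    eLpNorm (lapTransform lam g) (ENNReal.ofReal q) (volume.restrict (Ioi 0))
      ≤ ∫⁻ y in Ioi (0:ℝ), ENNReal.ofReal (y ^ (-(lam / q))) * ‖g y‖ₑ := by
  have hq0 : 0 < q := by linarith
  rw [eLpNorm_eq_lintegral_rpow_enorm_toReal (by simpa using hq0) ENNReal.ofReal_ne_top,
    ENNReal.toReal_ofReal hq0.le, one_div, ENNReal.rpow_inv_le_iff hq0]
  refine le_trans ?_ (lintegral_rpow_lintegral_exp_mul_le hq hg.enorm)
  gcongr with x
  refine (enorm_integral_le_lintegral_enorm _).trans_eq ?_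
  simp_rw [enorm_exp_mul]

lemma ae_integrable_exp_mul {lam q : ℝ} (hq : 1 ≤ q) {g : ℝ → ℝ} (hg : Measurable g)
    (hfin : ∫⁻ y in Ioi (0:ℝ), ENNReal.ofReal (y ^ (-(lam / q))) * ‖g y‖ₑ ≠ ∞) :
    ∀ᵐ x ∂(volume.restrict (Ioi (0:ℝ))),
      IntegrableOn (fun y => Real.exp (-(x * y ^ lam)) * g y) (Ioi 0) := by
  have hq0 : 0 < q := by linarith
  have h := (lintegral_rpow_lintegral_exp_mul_le (lam := lam) hq hg.enorm).trans_lt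
    (ENNReal.rpow_lt_top_of_nonneg hq0.le hfin)
  have hm : Measurable (fun x : ℝ =>
      ∫⁻ y in Ioi (0:ℝ), ENNReal.ofReal (Real.exp (-(x * y ^ lam))) * ‖g y‖ₑ) := by
    refine Measurable.lintegral_prod_right'
      (f := fun p : ℝ × ℝ => ENNReal.ofReal (Real.exp (-(p.1 * p.2 ^ lam))) * ‖g p.2‖ₑ) ?_
    fun_prop
  filter_upwards [ae_lt_top (hm.pow_const q) h.ne] with x hx
  refine ⟨by fun_prop, ?_⟩
  rw [hasFiniteIntegral_iff_enorm]
  simp_rw [enorm_exp_mul]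
  exact (ENNReal.rpow_lt_top_iff_of_pos hq0).1 hx

lemma abs_exp_neg_sub_exp_neg_le {u w : ℝ} (hu : 0 ≤ u) (hw : 0 ≤ w) :
    |Real.exp (-u) - Real.exp (-w)| ≤ |u - w| := by
  wlog h : u ≤ w generalizing u w
  · rw [abs_sub_comm, abs_sub_comm u]
    exact this hw hu (le_of_not_ge h)
  have h1 : Real.exp (-w) = Real.exp (-u) * Real.exp (u - w) := by
    rw [← Real.exp_add]
    congr 1
    ring
  have h2 := Real.add_one_le_exp (u - w)
  have h3 : Real.exp (-u) ≤ 1 := Real.exp_le_one_iff.2 (by linarith)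
  have h4 : Real.exp (u - w) ≤ 1 := Real.exp_le_one_iff.2 (by linarith)
  rw [abs_of_nonneg (by rw [h1]; nlinarith [Real.exp_pos (-u)]), abs_of_nonpos (by linarith), h1]
  nlinarith [Real.exp_pos (-u)]

lemma abs_setIntegral_mul_le {g k : ℝ → ℝ} {C M : ℝ} (hC : 0 ≤ C) (hg : IntegrableOn g (Ioi 0))
    (hM : ∫ y in Ioi (0:ℝ), |g y| ≤ M) (hk : ∀ y, 0 < y → g y ≠ 0 → |k y| ≤ C) :
    |∫ y in Ioi (0:ℝ), k y * g y| ≤ C * M := by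
  calc |∫ y in Ioi (0:ℝ), k y * g y| ≤ ∫ y in Ioi (0:ℝ), C * |g y| := by
        rw [← Real.norm_eq_abs]
        refine norm_integral_le_of_norm_le (hg.abs.const_mul C) ?_
        filter_upwards [ae_restrict_mem measurableSet_Ioi] with y hy
        by_cases h0 : g y = 0
        · simp [h0]
        · rw [norm_mul, Real.norm_eq_abs, Real.norm_eq_abs]
          gcongr
          exact hk y hy h0
    _ = C * ∫ y in Ioi (0:ℝ), |g y| := integral_const_mul _ _
    _ ≤ C * M := by gcongr

lemma integrableOn_exp_mul {lam x : ℝ} (hx : 0 ≤ x) {g : ℝ → ℝ} (hg : IntegrableOn g (Ioi 0)) :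
    IntegrableOn (fun y => Real.exp (-(x * y ^ lam)) * g y) (Ioi 0) := by
  refine Integrable.bdd_mul (c := 1) hg (by fun_prop) ?_
  filter_upwards [ae_restrict_mem measurableSet_Ioi] with y hy
  have := Real.rpow_nonneg (le_of_lt hy) lam
  rw [Real.norm_eq_abs, Real.abs_exp]
  exact Real.exp_le_one_iff.2 (by nlinarith)

lemma abs_lapTransform_le {lam a b M x : ℝ} (hlam : 0 < lam) (ha : 0 < a) (hx : 0 ≤ x) {g : ℝ → ℝ}
    (hg : IntegrableOn g (Ioi 0)) (hM : ∫ y in Ioi (0:ℝ), |g y| ≤ M)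
    (hsupp : ∀ y, g y ≠ 0 → y ∈ Icc a b) :
    |lapTransform lam g x| ≤ Real.exp (-(x * a ^ lam)) * M := by
  refine abs_setIntegral_mul_le (Real.exp_pos _).le hg hM fun y hy h0 => ?_
  have := Real.rpow_le_rpow ha.le (hsupp y h0).1 hlam.le
  rw [Real.abs_exp]
  gcongr

lemma abs_lapTransform_sub_le {lam a b M x r : ℝ} (hlam : 0 < lam) (hx : 0 ≤ x)
    (hr : 0 ≤ r) {g : ℝ → ℝ} (hg : IntegrableOn g (Ioi 0)) (hM : ∫ y in Ioi (0:ℝ), |g y| ≤ M)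
    (hsupp : ∀ y, g y ≠ 0 → y ∈ Icc a b) :
    |lapTransform lam g x - lapTransform lam g r| ≤ |x - r| * |b| ^ lam * M := by
  rw [lapTransform, lapTransform, ← integral_sub (integrableOn_exp_mul hx hg)
    (integrableOn_exp_mul hr hg)]
  simp_rw [← sub_mul]
  refine abs_setIntegral_mul_le (by positivity) hg hM fun y hy h0 => ?_
  have h1 := hsupp y h0
  have h2 : y ^ lam ≤ |b| ^ lam := Real.rpow_le_rpow hy.le (h1.2.trans (le_abs_self b)) hlam.le
  have h3 := Real.rpow_nonneg hy.le lam
  refine (abs_exp_neg_sub_exp_neg_le (by positivity) (by positivity)).trans ?_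
  rw [← sub_mul, abs_mul, abs_of_nonneg h3]
  gcongr

lemma exists_tendsto_eLpNorm_lapTransform_sub {lam q a b M : ℝ} (hlam : 0 < lam) (hq : 1 ≤ q)
    (ha : 0 < a) {g : ℕ → ℝ → ℝ} (hgm : ∀ n, Measurable (g n)) (hg : ∀ n, IntegrableOn (g n) (Ioi 0))
    (hM : ∀ n, ∫ y in Ioi (0:ℝ), |g n y| ≤ M) (hsupp : ∀ n y, g n y ≠ 0 → y ∈ Icc a b)
    (hconv : ∀ r : ℚ, CauchySeq fun n => lapTransform lam (g n) |(r : ℝ)|) :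
    ∃ h : ℝ → ℝ, AEStronglyMeasurable h (volume.restrict (Ioi 0)) ∧
      Tendsto (fun n => eLpNorm (lapTransform lam (g n) - h) (ENNReal.ofReal q)
        (volume.restrict (Ioi 0))) atTop (𝓝 0) := by
  have hq0 : 0 < q := by linarith
  have hM0 : 0 ≤ M := (integral_nonneg fun y => abs_nonneg _).trans (hM 0)
  have hc : ∀ x : ℝ, 0 < x → CauchySeq fun n => lapTransform lam (g n) x := by
    intro x hx
    rw [Metric.cauchySeq_iff]
    intro ε hε
    set C := |b| ^ lam * M with hC
    have hC0 : 0 ≤ C := by positivity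
    obtain ⟨r, hr1, hr2⟩ := exists_rat_btwn (show x < x + ε / (4 * (C + 1)) by
      have : 0 < ε / (4 * (C + 1)) := by positivity
      linarith)
    have hr0 : (0:ℝ) ≤ r := by linarith
    have hclose : ∀ n, |lapTransform lam (g n) x - lapTransform lam (g n) r| ≤ ε / 4 := by
      intro n
      refine (abs_lapTransform_sub_le hlam hx.le hr0 (hg n) (hM n) (hsupp n)).trans ?_
      have h1 : |x - r| ≤ ε / (4 * (C + 1)) := by
        rw [abs_of_nonpos (by linarith)]
        linarith
      rw [mul_assoc, ← hC]
      calc |x - r| * C ≤ ε / (4 * (C + 1)) * (C + 1) := by gcongr; linarith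
        _ = ε / 4 := by field_simp
    obtain ⟨N, hN⟩ := Metric.cauchySeq_iff.1 (hconv r) (ε / 4) (by positivity)
    refine ⟨N, fun m hm n hn => ?_⟩
    have h1 := hN m hm n hn
    rw [Real.dist_eq, abs_of_nonneg hr0] at h1
    rw [Real.dist_eq]
    have h2 := abs_le.1 (hclose m)
    have h3 := abs_le.1 (hclose n)
    have h4 := abs_lt.1 h1
    rw [abs_lt]
    constructor <;> linarith
  have hlim : ∀ x : ℝ, ∃ l, 0 < x → Tendsto (fun n => lapTransform lam (g n) x) atTop (𝓝 l) := by
    intro x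
    by_cases hx : 0 < x
    · obtain ⟨l, hl⟩ := cauchySeq_tendsto_of_complete (hc x hx)
      exact ⟨l, fun _ => hl⟩
    · exact ⟨0, fun h => absurd h hx⟩
  choose h hh using hlim
  have hpos : ∀ᵐ x ∂(volume.restrict (Ioi (0:ℝ))), 0 < x := ae_restrict_mem measurableSet_Ioi
  have hmeas : ∀ n, AEStronglyMeasurable (lapTransform lam (g n)) (volume.restrict (Ioi 0)) :=
    fun n => (measurable_lapTransform lam (hgm n)).aestronglyMeasurable
  have hhm : AEStronglyMeasurable h (volume.restrict (Ioi 0)) :=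
    aestronglyMeasurable_of_tendsto_ae atTop hmeas (hpos.mono fun x hx => hh x hx)
  refine ⟨h, hhm, ?_⟩
  have key : Tendsto (fun n => ∫⁻ x in Ioi (0:ℝ), ‖(lapTransform lam (g n) - h) x‖ₑ ^ q) atTop
      (𝓝 (∫⁻ _ in Ioi (0:ℝ), 0)) := by
    refine tendsto_lintegral_of_dominated_convergence'
      (fun x => ENNReal.ofReal (2 * M) ^ q * ENNReal.ofReal (Real.exp (-(x * a ^ lam))) ^ q)
      (fun n => (((hmeas n).sub hhm).enorm).pow_const q) (fun n => ?_) ?_ ?_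
    · filter_upwards [hpos] with x hx
      have hb : ∀ n, |lapTransform lam (g n) x| ≤ Real.exp (-(x * a ^ lam)) * M := fun n =>
        abs_lapTransform_le hlam ha hx.le (hg n) (hM n) (hsupp n)
      have hb' : |h x| ≤ Real.exp (-(x * a ^ lam)) * M :=
        le_of_tendsto (hh x hx).abs (Eventually.of_forall hb)
      rw [← ENNReal.mul_rpow_of_nonneg _ _ hq0.le, ← ENNReal.ofReal_mul (by positivity),
        Real.enorm_eq_ofReal_abs]
      gcongr
      refine (abs_sub _ _).trans ?_
      have := hb n
      linarith
    · rw [lintegral_const_mul _ (by fun_prop), lintegral_exp_rpow hq0 (by positivity)]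
      exact ENNReal.mul_ne_top (ENNReal.rpow_ne_top_of_nonneg hq0.le ENNReal.ofReal_ne_top)
        ENNReal.ofReal_ne_top
    · filter_upwards [hpos] with x hx
      have h1 : Tendsto (fun n => (lapTransform lam (g n) - h) x) atTop (𝓝 0) := by
        simpa using (hh x hx).sub_const (h x)
      have h2 := (ENNReal.continuous_rpow_const (y := q)).continuousAt.tendsto.comp h1.enorm
      simpa [Function.comp_def, hq0] using h2
  simp_rw [eLpNorm_eq_lintegral_rpow_enorm_toReal
    (show ENNReal.ofReal q ≠ 0 by simpa using hq0) ENNReal.ofReal_ne_top,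
    ENNReal.toReal_ofReal hq0.le]
  have h2 := (ENNReal.continuous_rpow_const (y := 1 / q)).continuousAt.tendsto.comp key
  simpa [Function.comp_def, hq0] using h2

/-- Sufficiency: an essentially bounded `y^{-λ/q} v(y)` that essentially vanishes at `0` and `∞`
gives a compact operator. -/
theorem lapCompact_of_vanishing {lam q : ℝ} (hlam : 0 < lam) (hq : 1 ≤ q) {v : ℝ → ℝ}
    (hv : Measurable v) (hvpos : ∀ y, 0 ≤ v y) {W : ℝ}
    (hW : ∀ᵐ y ∂(volume.restrict (Ioi (0:ℝ))), y ^ (-(lam / q)) * v y ≤ W)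
    (hvan : ∀ η : ℝ, 0 < η → ∃ a b : ℝ, 0 < a ∧
      ∀ᵐ y ∂(volume.restrict (Ioi (0:ℝ))), y ∉ Icc a b → y ^ (-(lam / q)) * v y ≤ η) :
    LapCompact lam 1 q v := by
  have hq0 : 0 < q := by linarith
  have hθ : 0 < lam / q := by positivity
  intro f hfm hf1
  set μ : Measure ℝ := volume.restrict (Ioi (0:ℝ)) with hμ
  have hpos : ∀ᵐ x ∂μ, 0 < x := ae_restrict_mem measurableSet_Ioi
  have hf1' : ∀ n, ∫⁻ y, ‖f n y‖ₑ ∂μ ≤ 1 := by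
    intro n
    have := hf1 n
    rwa [eN_eq_eLpNorm one_pos, ENNReal.ofReal_one, eLpNorm_one_eq_lintegral_enorm] at this
  have hfint : ∀ n, Integrable (f n) μ := fun n =>
    ⟨(hfm n).aestronglyMeasurable, (hf1' n).trans_lt ENNReal.one_lt_top⟩
  have hfabs : ∀ n, ∫ y, |f n y| ∂μ ≤ 1 := by
    intro n
    have := integral_norm_eq_lintegral_enorm (hfm n).aestronglyMeasurable (μ := μ)
    simp only [Real.norm_eq_abs] at this
    rw [this]
    exact ENNReal.toReal_le_of_le_ofReal zero_le_one (by simpa using hf1' n)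
  let A : ℕ → Set ℝ := fun k => Icc (1 / ((k:ℝ) + 1)) ((k:ℝ) + 1)
  have hA : ∀ k, MeasurableSet (A k) := fun k => measurableSet_Icc
  let F : ℕ → ℝ → ℝ := fun n y => f n y * v y
  have hFm : ∀ n, Measurable (F n) := fun n => (hfm n).mul hv
  let C : ℕ → ℝ := fun k => |W| * ((k:ℝ) + 1) ^ (lam / q)
  have hC0 : ∀ k, 0 ≤ C k := fun k => by positivity
  have hbd : ∀ k n, ∀ᵐ y ∂μ, ‖(A k).indicator (F n) y‖ ≤ C k * |f n y| := by
    intro k n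
    filter_upwards [hpos, hW] with y hy hy2
    by_cases hyA : y ∈ A k
    · rw [indicator_of_mem hyA]
      have h1 : v y ≤ C k := by
        have h2 : v y = y ^ (lam / q) * (y ^ (-(lam / q)) * v y) := by
          rw [← mul_assoc, ← Real.rpow_add hy]
          simp
        rw [h2, mul_comm]
        have := hvpos y
        exact mul_le_mul (hy2.trans (le_abs_self W)) (Real.rpow_le_rpow hy.le hyA.2 hθ.le)
          (by positivity) (abs_nonneg W)
      simp only [F, norm_mul, Real.norm_eq_abs, abs_of_nonneg (hvpos y)]
      rw [mul_comm]
      gcongr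
    · rw [indicator_of_notMem hyA, norm_zero]
      have := hC0 k
      positivity
  have hgint : ∀ k n, Integrable ((A k).indicator (F n)) μ := fun k n =>
    ((hfint n).abs.const_mul (C k)).mono' ((hFm n).indicator (hA k)).aestronglyMeasurable (hbd k n)
  have hgM : ∀ k n, ∫ y, |(A k).indicator (F n) y| ∂μ ≤ C k := by
    intro k n
    calc _ ≤ ∫ y, C k * |f n y| ∂μ :=
          integral_mono_ae (hgint k n).abs ((hfint n).abs.const_mul (C k)) (hbd k n)
      _ = C k * ∫ y, |f n y| ∂μ := integral_const_mul _ _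
      _ ≤ C k := mul_le_of_le_one_right (hC0 k) (hfabs n)
  have hsupp : ∀ k n y, (A k).indicator (F n) y ≠ 0 → y ∈ A k :=
    fun k n y h => mem_of_indicator_ne_zero h
  have hak : ∀ k : ℕ, (0:ℝ) < 1 / ((k:ℝ) + 1) := fun k => by positivity
  -- diagonal extraction at all truncation levels and all rational points
  let c : ℕ → (ℕ × ℚ → ℝ) := fun n i => lapTransform lam ((A i.1).indicator (F n)) |(i.2:ℝ)|
  obtain ⟨l, -, φ, hφ, hl⟩ := (isCompact_univ_pi
    (fun i : ℕ × ℚ => isCompact_Icc (a := -C i.1) (b := C i.1))).tendsto_subseq (x := c) (by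
      intro n i _
      rw [mem_Icc, ← abs_le]
      refine (abs_lapTransform_le hlam (hak i.1) (abs_nonneg _) (hgint i.1 n) (hgM i.1 n)
        (hsupp i.1 n)).trans ?_
      refine mul_le_of_le_one_left (hC0 _) (Real.exp_le_one_iff.2 ?_)
      have := hak i.1
      have : (0:ℝ) ≤ |(i.2:ℝ)| * (1 / ((i.1:ℝ) + 1)) ^ lam := by positivity
      linarith)
  rw [tendsto_pi_nhds] at hl
  refine ⟨φ, hφ, fun ε hε => ?_⟩
  obtain ⟨a, b, ha, hab⟩ := hvan (ε / 4) (by positivity)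
  obtain ⟨k, hk⟩ := exists_nat_ge (max (1 / a) b)
  have hkA : Icc a b ⊆ A k := by
    intro y hy
    have h1 : 1 / a ≤ k := (le_max_left _ _).trans hk
    have h2 : b ≤ k := (le_max_right _ _).trans hk
    refine ⟨?_, by linarith [hy.2]⟩
    refine le_trans ?_ hy.1
    rw [div_le_iff₀ (by positivity)]
    rw [div_le_iff₀ ha] at h1
    linarith
  have hrest : ∀ n, ∫⁻ y, ENNReal.ofReal (y ^ (-(lam / q))) * ‖(A k)ᶜ.indicator (F n) y‖ₑ ∂μ
      ≤ ENNReal.ofReal (ε / 4) := by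
    intro n
    calc _ ≤ ∫⁻ y, ENNReal.ofReal (ε / 4) * ‖f n y‖ₑ ∂μ := by
          refine lintegral_mono_ae ?_
          filter_upwards [hpos, hab] with y hy hy2
          by_cases hyA : y ∈ A k
          · rw [indicator_of_notMem (by simpa using hyA)]
            simp
          · rw [indicator_of_mem (by simpa using hyA)]
            have h3 := hy2 fun h => hyA (hkA h)
            simp only [F]
            rw [enorm_mul, Real.enorm_eq_ofReal (hvpos y), mul_comm ‖f n y‖ₑ, ← mul_assoc,
              ← ENNReal.ofReal_mul (by positivity)]
            gcongr
      _ = ENNReal.ofReal (ε / 4) * ∫⁻ y, ‖f n y‖ₑ ∂μ := lintegral_const_mul _ (hfm n).enorm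
      _ ≤ ENNReal.ofReal (ε / 4) := mul_le_of_le_one_right' (hf1' n)
  have hRm : ∀ n, Measurable ((A k)ᶜ.indicator (F n)) := fun n => (hFm n).indicator (hA k).compl
  have hsplit : ∀ n, lapTransform lam (F n) =ᵐ[μ]
      lapTransform lam ((A k).indicator (F n)) + lapTransform lam ((A k)ᶜ.indicator (F n)) := by
    intro n
    filter_upwards [hpos, ae_integrable_exp_mul hq (hRm n)
      ((hrest n).trans_lt ENNReal.ofReal_lt_top).ne] with x hx hx2
    simp only [Pi.add_apply, lapTransform]
    rw [← integral_add (integrableOn_exp_mul hx.le (hgint k n)) hx2]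
    congr 1
    funext y
    rw [← mul_add]
    congr 1
    exact (indicator_self_add_compl_apply (A k) (F n) y).symm
  have hrestN : ∀ n, eLpNorm (lapTransform lam ((A k)ᶜ.indicator (F n))) (ENNReal.ofReal q) μ
      ≤ ENNReal.ofReal (ε / 4) := fun n => (eLpNorm_lapTransform_le hq (hRm n)).trans (hrest n)
  obtain ⟨h, hhm, hh⟩ := exists_tendsto_eLpNorm_lapTransform_sub (q := q)
    (g := fun n => (A k).indicator (F (φ n)))
    hlam hq (hak k) (fun n => (hFm _).indicator (hA k)) (fun n => hgint k _) (fun n => hgM k _)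
    (fun n => hsupp k _) (fun r => (hl (k, r)).cauchySeq)
  have hev := hh.eventually (gt_mem_nhds (show 0 < ENNReal.ofReal (ε / 4) by simpa using hε))
  obtain ⟨N, hN⟩ := eventually_atTop.1 hev
  have hq1 : 1 ≤ ENNReal.ofReal q := by simpa using hq
  have hp : ∀ n, N ≤ n → eLpNorm (lapTransform lam (F (φ n)) - h) (ENNReal.ofReal q) μ
      < ENNReal.ofReal (ε / 2) := by
    intro n hn
    have heq : lapTransform lam (F (φ n)) - h =ᵐ[μ]
        (lapTransform lam ((A k).indicator (F (φ n))) - h)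
          + lapTransform lam ((A k)ᶜ.indicator (F (φ n))) := by
      filter_upwards [hsplit (φ n)] with x hx
      simp only [Pi.sub_apply, Pi.add_apply, hx]
      ring
    rw [eLpNorm_congr_ae heq]
    refine (eLpNorm_add_le
      ((measurable_lapTransform lam ((hFm _).indicator (hA k))).aestronglyMeasurable.sub hhm)
      (measurable_lapTransform lam (hRm _)).aestronglyMeasurable hq1).trans_lt ?_
    refine (ENNReal.add_lt_add_of_lt_of_le ((hrestN _).trans_lt ENNReal.ofReal_lt_top).ne
      (hN n hn) (hrestN (φ n))).trans_eq ?_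
    rw [← ENNReal.ofReal_add (by positivity) (by positivity)]
    congr 1
    ring
  refine ⟨N, fun m hm n hn => ?_⟩
  rw [eN_eq_eLpNorm hq0, Lap_eq_lapTransform, Lap_eq_lapTransform]
  have heq : (fun x => lapTransform lam (F (φ m)) x - lapTransform lam (F (φ n)) x)
      = (lapTransform lam (F (φ m)) - h) - (lapTransform lam (F (φ n)) - h) := by
    funext x
    simp
  have hmF : ∀ n, AEStronglyMeasurable (lapTransform lam (F (φ n)) - h) μ := fun n =>
    (measurable_lapTransform lam (hFm _)).aestronglyMeasurable.sub hhm
  refine lt_of_eq_of_lt (congrArg (fun u => eLpNorm u (ENNReal.ofReal q) μ) heq) ?_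
  refine (eLpNorm_sub_le (hmF m) (hmF n) hq1).trans_lt ?_
  refine (ENNReal.add_lt_add (hp m hm) (hp n hn)).trans_eq ?_
  rw [← ENNReal.ofReal_add (by positivity) (by positivity)]
  congr 1
  ring

lemma exists_dyadic_inter_ne_zero {E : Set ℝ} (hE0 : E ⊆ Ioi 0) (hE : volume E ≠ 0) :
    ∃ s : ℝ, 0 < s ∧ volume (E ∩ Ico s (2 * s)) ≠ 0 := by
  by_contra! hcon
  refine hE (measure_mono_null (t := ⋃ k : ℤ, E ∩ Ico ((2:ℝ) ^ k) (2 * 2 ^ k)) ?_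
    (measure_iUnion_null fun k => hcon _ (by positivity)))
  intro y hy
  obtain ⟨k, hk⟩ := exists_mem_Ico_zpow (hE0 hy) (one_lt_two (α := ℝ))
  rw [zpow_add_one₀ two_ne_zero, mul_comm] at hk
  exact mem_iUnion.2 ⟨k, hy, hk⟩

/-- A test function concentrated on a set `E` where `y^{-λ/q} v(y) ≥ c`. -/
lemma exists_test_function {lam q : ℝ} (hlam : 0 < lam) (hq : 1 ≤ q) {v : ℝ → ℝ}
    (hv : Measurable v) {E : Set ℝ} (hEm : MeasurableSet E)
    (hE : volume E ≠ 0) {s c : ℝ} (hs : 0 < s) (hc : 0 < c) (hEs : E ⊆ Ico s (2 * s))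
    (hcw : ∀ y ∈ E, c ≤ y ^ (-(lam / q)) * v y) :
    ∃ f : ℝ → ℝ, Measurable f ∧ eN 1 f ≤ 1 ∧ Measurable (Lap lam v f) ∧
      (∀ x, 0 < x → 0 ≤ Lap lam v f x) ∧
      (∀ x m, 0 < x → (∀ y ∈ E, Real.exp (-(x * y ^ lam)) * y ^ (lam / q) ≤ m) →
        Lap lam v f x ≤ c * m) ∧
      eLpNorm (Lap lam v f) (ENNReal.ofReal q) (volume.restrict (Ioi 0)) ≠ ∞ ∧
      ENNReal.ofReal (c * (1 / (q * 2 ^ lam)) ^ (1 / q))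
        ≤ eLpNorm (Lap lam v f) (ENNReal.ofReal q) (volume.restrict (Ioi 0)) := by
  have hq0 : 0 < q := by linarith
  have hθ : 0 < lam / q := by positivity
  have hEpos : ∀ y ∈ E, 0 < y := fun y hy => hs.trans_le (hEs hy).1
  have hE0 : E ⊆ Ioi 0 := hEpos
  have hEtop : volume E ≠ ∞ := ((measure_mono hEs).trans_lt (by simp)).ne
  set V := volume.real E with hVdef
  have hV : 0 < V := ENNReal.toReal_pos hE hEtop
  have hVE : ENNReal.ofReal V = volume E := ENNReal.ofReal_toReal hEtop
  set f : ℝ → ℝ := E.indicator (fun y => c / (y ^ (-(lam / q)) * v y * V)) with hf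
  have hfm : Measurable f := by
    refine Measurable.indicator ?_ hEm
    fun_prop
  set g : ℝ → ℝ := E.indicator (fun y => c / V * y ^ (lam / q)) with hg
  have hgm : Measurable g := by
    refine Measurable.indicator ?_ hEm
    fun_prop
  have hfg : (fun y => f y * v y) = g := by
    funext y
    by_cases hy : y ∈ E
    · have hw := hc.trans_le (hcw y hy)
      have hy0 := hEpos y hy
      have hvne : v y ≠ 0 := fun h => by simp [h] at hw
      simp only [hf, hg, indicator_of_mem hy]
      rw [Real.rpow_neg hy0.le]
      have := (Real.rpow_pos_of_pos hy0 (lam / q)).ne'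
      field_simp
    · simp [hf, hg, indicator_of_notMem hy]
  have hLap : Lap lam v f = lapTransform lam g := by rw [Lap_eq_lapTransform, hfg]
  have hform : ∀ x, Lap lam v f x
      = ∫ y in E, c / V * (Real.exp (-(x * y ^ lam)) * y ^ (lam / q)) := by
    intro x
    rw [hLap, lapTransform]
    have h1 : (fun y => Real.exp (-(x * y ^ lam)) * g y) = E.indicator
        (fun y => c / V * (Real.exp (-(x * y ^ lam)) * y ^ (lam / q))) := by
      funext y
      by_cases hy : y ∈ E
      · simp only [hg, indicator_of_mem hy]
        ring
      · simp [hg, indicator_of_notMem hy]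
    rw [h1, integral_indicator hEm, Measure.restrict_restrict hEm, inter_eq_left.2 hE0]
  have hconst : ∀ m : ℝ, ∫ _ in E, c / V * m = c * m := by
    intro m
    rw [setIntegral_const, smul_eq_mul, ← hVdef]
    field_simp
  have hint : ∀ x, 0 < x →
      IntegrableOn (fun y => c / V * (Real.exp (-(x * y ^ lam)) * y ^ (lam / q))) E := by
    intro x hx
    refine Integrable.mono' (g := fun _ => c / V * (2 * s) ^ (lam / q))
      (integrableOn_const hEtop enorm_ne_top) (by fun_prop) ?_
    filter_upwards [ae_restrict_mem hEm] with y hy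
    have hy0 := hEpos y hy
    rw [Real.norm_of_nonneg (by positivity)]
    gcongr
    calc Real.exp (-(x * y ^ lam)) * y ^ (lam / q) ≤ 1 * (2 * s) ^ (lam / q) := by
          gcongr
          · refine Real.exp_le_one_iff.2 ?_
            have : 0 ≤ x * y ^ lam := by positivity
            linarith
          · exact (hEs hy).2.le
      _ = _ := one_mul _
  have hlow : ∀ x m, 0 < x → (∀ y ∈ E, m ≤ Real.exp (-(x * y ^ lam)) * y ^ (lam / q)) →
      c * m ≤ Lap lam v f x := by
    intro x m hx hm
    rw [hform, ← hconst m]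
    refine setIntegral_mono_on (integrableOn_const hEtop enorm_ne_top) (hint x hx)
      hEm fun y hy => ?_
    have := hm y hy
    gcongr
  refine ⟨f, hfm, ?_, ?_, ?_, ?_, ?_, ?_⟩
  · rw [eN_eq_eLpNorm one_pos, ENNReal.ofReal_one, eLpNorm_one_eq_lintegral_enorm]
    calc ∫⁻ y in Ioi (0:ℝ), ‖f y‖ₑ
        ≤ ∫⁻ y in Ioi (0:ℝ), E.indicator (fun _ => ENNReal.ofReal (1 / V)) y := by
          refine lintegral_mono fun y => ?_
          by_cases hy : y ∈ E
          · have hw := hcw y hy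
            have hw0 := hc.trans_le hw
            simp only [hf, indicator_of_mem hy]
            rw [Real.enorm_eq_ofReal (by positivity)]
            refine ENNReal.ofReal_le_ofReal ?_
            rw [div_le_div_iff₀ (by positivity) hV, one_mul]
            gcongr
          · simp [hf, indicator_of_notMem hy]
      _ = ENNReal.ofReal (1 / V) * volume E := by
          rw [lintegral_indicator_const hEm, Measure.restrict_apply hEm, inter_eq_left.2 hE0]
      _ ≤ 1 := by
          rw [← hVE, ← ENNReal.ofReal_mul (by positivity), one_div_mul_cancel hV.ne']
          simp
  · rw [hLap]
    exact measurable_lapTransform lam hgm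
  · intro x hx
    have := hlow x 0 hx fun y hy => by
      have := hEpos y hy
      positivity
    simpa using this
  · intro x m hx hm
    rw [hform, ← hconst m]
    refine setIntegral_mono_on (hint x hx) (integrableOn_const hEtop enorm_ne_top)
      hEm fun y hy => ?_
    have := hm y hy
    gcongr
  · rw [hLap]
    refine ((eLpNorm_lapTransform_le hq hgm).trans_lt ?_).ne
    calc ∫⁻ y in Ioi (0:ℝ), ENNReal.ofReal (y ^ (-(lam / q))) * ‖g y‖ₑ
        = ∫⁻ y in Ioi (0:ℝ), E.indicator (fun _ => ENNReal.ofReal (c / V)) y := by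
          refine lintegral_congr fun y => ?_
          by_cases hy : y ∈ E
          · have hy0 := hEpos y hy
            simp only [hg, indicator_of_mem hy]
            rw [Real.enorm_eq_ofReal (by positivity), ← ENNReal.ofReal_mul (by positivity),
              mul_left_comm, ← Real.rpow_add hy0]
            simp
          · simp [hg, indicator_of_notMem hy]
      _ < ∞ := by
          rw [lintegral_indicator_const hEm, Measure.restrict_apply hEm, inter_eq_left.2 hE0]
          exact ENNReal.mul_lt_top ENNReal.ofReal_lt_top hEtop.lt_top
  · have hval : ENNReal.ofReal (c * (1 / (q * 2 ^ lam)) ^ (1 / q))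
        = (∫⁻ x in Ioi (0:ℝ), ENNReal.ofReal (c * s ^ (lam / q)) ^ q
          * ENNReal.ofReal (Real.exp (-(x * (2 * s) ^ lam))) ^ q) ^ (1 / q) := by
      rw [lintegral_const_mul _ (by fun_prop), lintegral_exp_rpow hq0 (by positivity),
        ENNReal.mul_rpow_of_nonneg _ _ (by positivity), ← ENNReal.rpow_mul,
        mul_one_div_cancel hq0.ne', ENNReal.rpow_one,
        ENNReal.ofReal_rpow_of_pos (by positivity), ← ENNReal.ofReal_mul (by positivity)]
      congr 1
      rw [mul_assoc]
      congr 1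
      rw [show lam / q = lam * (1 / q) by ring, Real.rpow_mul hs.le,
        ← Real.mul_rpow (by positivity) (by positivity), Real.mul_rpow zero_le_two hs.le]
      congr 1
      have := (Real.rpow_pos_of_pos hs lam).ne'
      field_simp
    rw [hval, eLpNorm_eq_lintegral_rpow_enorm_toReal (by simpa using hq0) ENNReal.ofReal_ne_top,
      ENNReal.toReal_ofReal hq0.le]
    gcongr ?_ ^ (1 / q)
    refine lintegral_mono_ae ?_
    filter_upwards [ae_restrict_mem measurableSet_Ioi] with x hx
    rw [← ENNReal.mul_rpow_of_nonneg _ _ hq0.le, ← ENNReal.ofReal_mul (by positivity),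
      Real.enorm_eq_ofReal_abs]
    gcongr
    refine le_trans ?_ (le_abs_self _)
    have := hlow x (Real.exp (-(x * (2 * s) ^ lam)) * s ^ (lam / q)) hx fun y hy => by
      have hy0 := hEpos y hy
      have hx0 : (0:ℝ) < x := hx
      have h1 := (hEs hy).1
      have h2 := (hEs hy).2.le
      gcongr
    calc _ = c * (Real.exp (-(x * (2 * s) ^ lam)) * s ^ (lam / q)) := by ring
      _ ≤ _ := this

/-- Compactness forces `y^{-λ/q} v(y)` to be essentially bounded. -/
lemma ae_bound_of_lapCompact {lam q : ℝ} (hlam : 0 < lam) (hq : 1 ≤ q) {v : ℝ → ℝ}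
    (hv : Measurable v) (hcomp : LapCompact lam 1 q v) :
    ∃ M : ℝ, 0 < M ∧ ∀ᵐ y ∂(volume.restrict (Ioi (0:ℝ))), y ^ (-(lam / q)) * v y ≤ M := by
  have hq0 : 0 < q := by linarith
  by_contra! hcon
  have hex : ∀ n : ℕ, ∃ (E : Set ℝ) (s : ℝ), MeasurableSet E ∧ volume E ≠ 0 ∧ 0 < s ∧
      E ⊆ Ico s (2 * s) ∧ ∀ y ∈ E, (n:ℝ) + 1 ≤ y ^ (-(lam / q)) * v y := by
    intro n
    have hm : MeasurableSet (Ioi (0:ℝ) ∩ {y | (n:ℝ) + 1 < y ^ (-(lam / q)) * v y}) :=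
      measurableSet_Ioi.inter (measurableSet_lt (by fun_prop) (by fun_prop))
    have hne : volume (Ioi (0:ℝ) ∩ {y | (n:ℝ) + 1 < y ^ (-(lam / q)) * v y}) ≠ 0 := by
      intro h0
      refine hcon (n + 1) (by positivity) ?_
      rw [ae_restrict_iff' measurableSet_Ioi]
      refine measure_mono_null (fun y hy => ?_) h0
      simpa using hy
    obtain ⟨s, hs, hs2⟩ := exists_dyadic_inter_ne_zero inter_subset_left hne
    exact ⟨_, s, hm.inter measurableSet_Ico, hs2, hs, inter_subset_right, fun y hy => hy.1.2.le⟩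
  choose E s hEm hE hs hEs hw using hex
  have hex2 := fun n => exists_test_function hlam hq hv (hEm n) (hE n) (hs n)
    (show (0:ℝ) < (n:ℝ) + 1 by positivity) (hEs n) (hw n)
  choose f hfm hf1 hLm _ _ hfin hlow using hex2
  obtain ⟨φ, hφ, hC⟩ := hcomp f hfm hf1
  obtain ⟨N, hN⟩ := hC 1 one_pos
  set μ : Measure ℝ := volume.restrict (Ioi (0:ℝ)) with hμ
  set κ : ℝ := (1 / (q * 2 ^ lam)) ^ (1 / q) with hκ
  have hκ0 : 0 < κ := by positivity
  have hbd : ∀ m, N ≤ m → ENNReal.ofReal (((φ m : ℕ) + 1) * κ)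
      ≤ 1 + eLpNorm (Lap lam v (f (φ N))) (ENNReal.ofReal q) μ := by
    intro m hm
    refine (hlow (φ m)).trans ?_
    have h1 := (hN m hm N le_rfl).le
    rw [eN_eq_eLpNorm hq0, ENNReal.ofReal_one] at h1
    have h2 : Lap lam v (f (φ m))
        = (fun x => Lap lam v (f (φ m)) x - Lap lam v (f (φ N)) x) + Lap lam v (f (φ N)) := by
      funext x
      simp
    calc _ = eLpNorm ((fun x => Lap lam v (f (φ m)) x - Lap lam v (f (φ N)) x)
          + Lap lam v (f (φ N))) (ENNReal.ofReal q) μ := by rw [← h2]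
      _ ≤ _ := eLpNorm_add_le ((hLm _).sub (hLm _)).aestronglyMeasurable
          (hLm _).aestronglyMeasurable (by simpa using hq)
      _ ≤ _ := by gcongr
  have htop : 1 + eLpNorm (Lap lam v (f (φ N))) (ENNReal.ofReal q) μ ≠ ∞ :=
    ENNReal.add_ne_top.2 ⟨ENNReal.one_ne_top, hfin _⟩
  obtain ⟨j, hj⟩ := exists_nat_gt
    ((1 + eLpNorm (Lap lam v (f (φ N))) (ENNReal.ofReal q) μ).toReal / κ)
  have h3 := hbd (max N j) (le_max_left _ _)
  rw [ENNReal.ofReal_le_iff_le_toReal htop] at h3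
  rw [div_lt_iff₀ hκ0] at hj
  have h4 : (j:ℝ) ≤ φ (max N j) := by
    exact_mod_cast (le_max_right N j).trans (hφ.id_le _)
  nlinarith

/-- Compactness forces `y^{-λ/q} v(y)` to vanish along every sequence of sets on which the
normalized kernel tends to zero pointwise. -/
lemma ae_small_of_lapCompact {lam q : ℝ} (hlam : 0 < lam) (hq : 1 ≤ q) {v : ℝ → ℝ}
    (hv : Measurable v) (hcomp : LapCompact lam 1 q v) {l : Filter ℝ}
    (hl : ∀ x, 0 < x → Tendsto (fun y => Real.exp (-(x * y ^ lam)) * y ^ (lam / q)) l (𝓝 0))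
    {U : ℕ → Set ℝ} (hUm : ∀ n, MeasurableSet (U n)) (hU : ∀ n, U n ⊆ Ioi 0)
    (hUl : Tendsto U atTop l.smallSets) {ε : ℝ} (hε : 0 < ε) :
    ∃ n, ∀ᵐ y ∂(volume.restrict (U n)), y ^ (-(lam / q)) * v y ≤ ε := by
  have hq0 : 0 < q := by linarith
  by_contra! hcon
  have hex : ∀ n : ℕ, ∃ (E : Set ℝ) (s : ℝ), MeasurableSet E ∧ volume E ≠ 0 ∧ 0 < s ∧
      E ⊆ Ico s (2 * s) ∧ (∀ y ∈ E, ε ≤ y ^ (-(lam / q)) * v y) ∧ E ⊆ U n := by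
    intro n
    have hm : MeasurableSet (U n ∩ {y | ε < y ^ (-(lam / q)) * v y}) :=
      (hUm n).inter (measurableSet_lt (by fun_prop) (by fun_prop))
    have hne : volume (U n ∩ {y | ε < y ^ (-(lam / q)) * v y}) ≠ 0 := by
      intro h0
      refine hcon n ?_
      rw [ae_restrict_iff' (hUm n)]
      refine measure_mono_null (fun y hy => ?_) h0
      simpa using hy
    obtain ⟨s, hs, hs2⟩ := exists_dyadic_inter_ne_zero (inter_subset_left.trans (hU n)) hne
    exact ⟨_, s, hm.inter measurableSet_Ico, hs2, hs, inter_subset_right,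
      fun y hy => hy.1.2.le, fun y hy => hy.1.1⟩
  choose E s hEm hE hs hEs hw hEU using hex
  have hex2 := fun n => exists_test_function hlam hq hv (hEm n) (hE n) (hs n) hε (hEs n) (hw n)
  choose f hfm hf1 hLm hnn hup _ hlow using hex2
  obtain ⟨φ, hφ, hC⟩ := hcomp f hfm hf1
  set μ : Measure ℝ := volume.restrict (Ioi (0:ℝ)) with hμ
  set κ : ℝ := (1 / (q * 2 ^ lam)) ^ (1 / q) with hκ
  have hκ0 : 0 < κ := by positivity
  obtain ⟨N, hN⟩ := hC (ε * κ / 2) (by positivity)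
  have hlim : ∀ x, 0 < x → Tendsto (fun n => Lap lam v (f n) x) atTop (𝓝 0) := by
    intro x hx
    rw [Metric.tendsto_atTop]
    intro δ hδ
    have h1 := (hl x hx).eventually (gt_mem_nhds (show 0 < δ / (2 * ε) by positivity))
    obtain ⟨n0, hn0⟩ := eventually_atTop.1 (hUl.eventually (eventually_smallSets_forall.2 h1))
    refine ⟨n0, fun n hn => ?_⟩
    have h2 := hup n x (δ / (2 * ε)) hx fun y hy => (hn0 n hn y (hEU n hy)).le
    rw [Real.dist_eq, sub_zero, abs_of_nonneg (hnn n x hx)]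
    refine h2.trans_lt ?_
    rw [show ε * (δ / (2 * ε)) = δ / 2 by field_simp]
    linarith
  have hfatou := Lp.eLpNorm_lim_le_liminf_eLpNorm (μ := μ) (p := ENNReal.ofReal q)
    (f := fun n x => Lap lam v (f (φ N)) x - Lap lam v (f (φ n)) x)
    (fun n => ((hLm _).sub (hLm _)).aestronglyMeasurable) (Lap lam v (f (φ N))) (by
      filter_upwards [ae_restrict_mem measurableSet_Ioi] with x hx
      simpa using ((hlim x hx).comp hφ.tendsto_atTop).const_sub (Lap lam v (f (φ N)) x))
  have hle : atTop.liminf (fun n => eLpNorm (fun x => Lap lam v (f (φ N)) x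
      - Lap lam v (f (φ n)) x) (ENNReal.ofReal q) μ) ≤ ENNReal.ofReal (ε * κ / 2) := by
    refine liminf_le_of_frequently_le' (Eventually.frequently ?_)
    filter_upwards [eventually_ge_atTop N] with n hn
    have := (hN N le_rfl n hn).le
    rwa [eN_eq_eLpNorm hq0] at this
  have hfin := ((hlow (φ N)).trans hfatou).trans hle
  rw [ENNReal.ofReal_le_ofReal_iff (by positivity)] at hfin
  nlinarith [mul_pos hε hκ0]

/-- The quantity `t^{-θ} ess sup_{0<x<t} v(x)`. -/
def normalizedEssSup (θ : ℝ) (v : ℝ → ℝ) (t : ℝ) : ℝ≥0∞ :=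
  ENNReal.ofReal t ^ (-θ) *
    essSup (fun x => ENNReal.ofReal (v x)) (volume.restrict (Ioo (0:ℝ) t))

lemma normalizedEssSup_le {θ : ℝ} {v : ℝ → ℝ} {t C : ℝ} (ht : 0 < t)
    (h : ∀ᵐ y ∂(volume.restrict (Ioo 0 t)), v y ≤ C * t ^ θ) :
    normalizedEssSup θ v t ≤ ENNReal.ofReal C := by
  have h1 : essSup (fun x => ENNReal.ofReal (v x)) (volume.restrict (Ioo (0:ℝ) t))
      ≤ ENNReal.ofReal (C * t ^ θ) :=
    essSup_le_of_ae_le _ (h.mono fun y hy => ENNReal.ofReal_le_ofReal hy)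
  calc _ ≤ ENNReal.ofReal t ^ (-θ) * ENNReal.ofReal (C * t ^ θ) := by
        unfold normalizedEssSup
        gcongr
    _ = ENNReal.ofReal C := by
      rw [ENNReal.ofReal_rpow_of_pos ht, ← ENNReal.ofReal_mul (by positivity), mul_left_comm,
        ← Real.rpow_add ht]
      simp

lemma ae_exists_le_normalizedEssSup {θ : ℝ} (hθ : 0 < θ) {v : ℝ → ℝ} (hvpos : ∀ y, 0 ≤ v y) :
    ∀ᵐ y ∂(volume.restrict (Ioi (0:ℝ))), ∃ t, y < t ∧ t ≤ 2 * y ∧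
      ENNReal.ofReal (y ^ (-θ) * v y) ≤ ENNReal.ofReal (2 ^ θ) * normalizedEssSup θ v t := by
  have h1 : ∀ k : ℤ, ∀ᵐ y ∂(volume : Measure ℝ), y ∈ Ioo (0:ℝ) (2 ^ k) → ENNReal.ofReal (v y)
      ≤ essSup (fun x => ENNReal.ofReal (v x)) (volume.restrict (Ioo (0:ℝ) (2 ^ k))) := fun k =>
    (ae_restrict_iff' measurableSet_Ioo).1 (ENNReal.ae_le_essSup _)
  rw [ae_restrict_iff' measurableSet_Ioi]
  filter_upwards [ae_all_iff.2 h1] with y hy hy0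
  have hy0 : 0 < y := hy0
  obtain ⟨k, hk1, hk2⟩ := exists_mem_Ico_zpow hy0 (one_lt_two (α := ℝ))
  have ht2 : (2:ℝ) ^ (k + 1) ≤ 2 * y := by
    rw [zpow_add_one₀ two_ne_zero]
    linarith
  refine ⟨2 ^ (k + 1), hk2, ht2, ?_⟩
  have hkey := hy (k + 1) ⟨hy0, hk2⟩
  set t : ℝ := 2 ^ (k + 1) with ht
  have ht0 : 0 < t := by positivity
  have h3 : y ^ (-θ) ≤ 2 ^ θ * t ^ (-θ) := by
    have h4 : (2 * y) ^ (-θ) ≤ t ^ (-θ) :=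
      Real.rpow_le_rpow_of_nonpos ht0 ht2 (by linarith)
    calc y ^ (-θ) = 2 ^ θ * (2 * y) ^ (-θ) := by
          rw [Real.mul_rpow zero_le_two hy0.le, ← mul_assoc, ← Real.rpow_add two_pos]
          simp
      _ ≤ _ := by gcongr
  calc ENNReal.ofReal (y ^ (-θ) * v y) ≤ ENNReal.ofReal (2 ^ θ * t ^ (-θ) * v y) := by
        have := hvpos y
        gcongr
    _ = ENNReal.ofReal (2 ^ θ) * (ENNReal.ofReal t ^ (-θ) * ENNReal.ofReal (v y)) := by
        rw [ENNReal.ofReal_mul (by positivity), ENNReal.ofReal_mul (by positivity),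
          ENNReal.ofReal_rpow_of_pos ht0, mul_assoc]
    _ ≤ _ := by
        unfold normalizedEssSup
        gcongr

/-- Necessity of the three conditions. -/
theorem conditions_of_lapCompact {lam q : ℝ} (hlam : 0 < lam) (hq : 1 ≤ q) {v : ℝ → ℝ}
    (hv : Measurable v) (hcomp : LapCompact lam 1 q v) :
    essSup (normalizedEssSup (lam / q) v) (volume.restrict (Ioi (0:ℝ))) < ⊤
      ∧ Tendsto (normalizedEssSup (lam / q) v) (𝓝[>] 0) (𝓝 0)
      ∧ Tendsto (normalizedEssSup (lam / q) v) atTop (𝓝 0) := by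
  have hq0 : 0 < q := by linarith
  have hθ : 0 < lam / q := by positivity
  have hmul : ∀ {y C : ℝ}, 0 < y → y ^ (-(lam / q)) * v y ≤ C → v y ≤ C * y ^ (lam / q) := by
    intro y C hy h
    rwa [Real.rpow_neg hy.le, inv_mul_le_iff₀ (by positivity), mul_comm] at h
  obtain ⟨M, hM0, hM⟩ := ae_bound_of_lapCompact hlam hq hv hcomp
  rw [ae_restrict_iff' measurableSet_Ioi] at hM
  refine ⟨?_, ?_, ?_⟩
  · refine lt_of_le_of_lt (essSup_le_of_ae_le (ENNReal.ofReal M) ?_) ENNReal.ofReal_lt_top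
    filter_upwards [ae_restrict_mem measurableSet_Ioi] with t ht
    refine normalizedEssSup_le ht ((ae_restrict_iff' measurableSet_Ioo).2 ?_)
    filter_upwards [hM] with y hy hyt
    refine (hmul hyt.1 (hy hyt.1)).trans ?_
    have h1 := hyt.1
    have h2 := hyt.2
    gcongr
  · rw [ENNReal.tendsto_nhds_zero]
    intro ε hε
    obtain ⟨δ, hδ0, hδ⟩ := ENNReal.lt_iff_exists_real_btwn.1 hε
    have hδ' : 0 < δ := by simpa using hδ.1
    obtain ⟨n, hn⟩ := ae_small_of_lapCompact hlam hq hv hcomp (l := 𝓝[>] 0)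
      (U := fun n : ℕ => Ioo 0 (1 / ((n:ℝ) + 1))) (fun x hx => by
        have h1 : Continuous (fun y : ℝ => Real.exp (-(x * y ^ lam)) * y ^ (lam / q)) := by
          have := Real.continuous_rpow_const hlam.le
          have := Real.continuous_rpow_const hθ.le
          fun_prop
        have h2 := h1.tendsto 0
        rw [Real.zero_rpow hθ.ne', mul_zero] at h2
        exact h2.mono_left nhdsWithin_le_nhds)
      (fun n => measurableSet_Ioo) (fun n => Ioo_subset_Ioi_self) (by
        rw [tendsto_smallSets_iff]
        intro S hS
        obtain ⟨u, hu, huS⟩ := mem_nhdsGT_iff_exists_Ioo_subset.1 hS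
        filter_upwards [tendsto_one_div_add_atTop_nhds_zero_nat.eventually
          (gt_mem_nhds (mem_Ioi.1 hu))] with n hn
        exact (Ioo_subset_Ioo_right hn.le).trans huS) hδ'
    rw [ae_restrict_iff' measurableSet_Ioo] at hn
    filter_upwards [Ioo_mem_nhdsGT (show (0:ℝ) < 1 / ((n:ℝ) + 1) by positivity)] with t ht
    refine (normalizedEssSup_le ht.1 ((ae_restrict_iff' measurableSet_Ioo).2 ?_)).trans hδ.2.le
    filter_upwards [hn] with y hy hyt
    refine (hmul hyt.1 (hy ⟨hyt.1, hyt.2.trans ht.2⟩)).trans ?_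
    have h1 := hyt.1
    have h2 := hyt.2
    gcongr
  · rw [ENNReal.tendsto_nhds_zero]
    intro ε hε
    obtain ⟨δ, hδ0, hδ⟩ := ENNReal.lt_iff_exists_real_btwn.1 hε
    have hδ' : 0 < δ := by simpa using hδ.1
    obtain ⟨n, hn⟩ := ae_small_of_lapCompact hlam hq hv hcomp (l := atTop)
      (U := fun n : ℕ => Ioi (n:ℝ)) (fun x hx => by
        have h1 := (tendsto_rpow_mul_exp_neg_mul_atTop_nhds_zero (1 / q) x hx).comp
          (tendsto_rpow_atTop hlam)
        refine h1.congr' ?_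
        filter_upwards [eventually_gt_atTop 0] with y hy
        simp only [Function.comp_apply]
        rw [← Real.rpow_mul hy.le, mul_one_div, mul_comm, neg_mul])
      (fun n => measurableSet_Ioi) (fun n => Ioi_subset_Ioi (Nat.cast_nonneg n)) (by
        rw [tendsto_smallSets_iff]
        intro S hS
        obtain ⟨u, hu⟩ := mem_atTop_sets.1 hS
        filter_upwards [tendsto_natCast_atTop_atTop.eventually_ge_atTop u] with n hn y hy
        exact hu y (hn.trans (le_of_lt hy))) hδ'
    rw [ae_restrict_iff' measurableSet_Ioi] at hn
    filter_upwards [eventually_gt_atTop 0,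
      (tendsto_rpow_atTop hθ).eventually_ge_atTop (M * (n:ℝ) ^ (lam / q) / δ)] with t ht ht2
    refine (normalizedEssSup_le ht ((ae_restrict_iff' measurableSet_Ioo).2 ?_)).trans hδ.2.le
    filter_upwards [hn, hM] with y hy hyM hyt
    have h1 := hyt.1
    have h2 := hyt.2
    rcases lt_or_ge (n:ℝ) y with h | h
    · refine (hmul h1 (hy h)).trans ?_
      gcongr
    · rw [div_le_iff₀ hδ'] at ht2
      calc v y ≤ M * y ^ (lam / q) := hmul h1 (hyM h1)
        _ ≤ M * (n:ℝ) ^ (lam / q) := by gcongr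
        _ ≤ δ * t ^ (lam / q) := by linarith

/-- The two vanishing conditions are sufficient for compactness. -/
theorem lapCompact_of_tendsto {lam q : ℝ} (hlam : 0 < lam) (hq : 1 ≤ q) {v : ℝ → ℝ}
    (hv : Measurable v) (hvpos : ∀ y, 0 ≤ v y)
    (h0 : Tendsto (normalizedEssSup (lam / q) v) (𝓝[>] 0) (𝓝 0))
    (h1 : Tendsto (normalizedEssSup (lam / q) v) atTop (𝓝 0)) : LapCompact lam 1 q v := by
  have hq0 : 0 < q := by linarith
  have hθ : 0 < lam / q := by positivity
  have hvan : ∀ η : ℝ, 0 < η → ∃ a b : ℝ, 0 < a ∧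
      ∀ᵐ y ∂(volume.restrict (Ioi (0:ℝ))), y ∉ Icc a b → y ^ (-(lam / q)) * v y ≤ η := by
    intro η hη
    have hη' : 0 < ENNReal.ofReal (η / 2 ^ (lam / q)) := by
      rw [ENNReal.ofReal_pos]
      positivity
    obtain ⟨u, hu, huS⟩ := mem_nhdsGT_iff_exists_Ioo_subset.1 (h0.eventually (gt_mem_nhds hη'))
    obtain ⟨b, hb⟩ := eventually_atTop.1 (h1.eventually (gt_mem_nhds hη'))
    have hu0 : (0:ℝ) < u := hu
    refine ⟨u / 2, b, by positivity, ?_⟩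
    filter_upwards [ae_exists_le_normalizedEssSup hθ hvpos, ae_restrict_mem measurableSet_Ioi]
      with y hy hy0 hyn
    have hy0 : 0 < y := hy0
    obtain ⟨t, ht1, ht2, ht⟩ := hy
    have hB : normalizedEssSup (lam / q) v t ≤ ENNReal.ofReal (η / 2 ^ (lam / q)) := by
      rcases lt_or_ge y (u / 2) with h | h
      · exact (huS (show t ∈ Ioo 0 u from ⟨by linarith, by linarith⟩) : _ < _).le
      · have : b < y := by
          by_contra hcon
          exact hyn ⟨h, not_lt.1 hcon⟩
        exact (hb t (by linarith)).le
    have h2 : ENNReal.ofReal (y ^ (-(lam / q)) * v y) ≤ ENNReal.ofReal η := by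
      refine ht.trans ((mul_le_mul_right hB _).trans_eq ?_)
      rw [← ENNReal.ofReal_mul (by positivity)]
      congr 1
      field_simp
    exact (ENNReal.ofReal_le_ofReal_iff hη.le).1 h2
  obtain ⟨a, b, ha, hab⟩ := hvan 1 one_pos
  obtain ⟨T, hTb, hT0, hT⟩ := ((eventually_gt_atTop b).and ((eventually_gt_atTop 0).and
    (h1.eventually (gt_mem_nhds (one_pos (α := ℝ≥0∞)))))).exists
  set S := essSup (fun x => ENNReal.ofReal (v x)) (volume.restrict (Ioo (0:ℝ) T)) with hS
  have hStop : S ≠ ∞ := by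
    intro h
    rw [normalizedEssSup, ← hS, h, ENNReal.ofReal_rpow_of_pos hT0, ENNReal.mul_top] at hT
    · exact absurd hT (by simp)
    · rw [Ne, ENNReal.ofReal_eq_zero, not_le]
      positivity
  have hSae : ∀ᵐ y ∂(volume : Measure ℝ), y ∈ Ioo 0 T → ENNReal.ofReal (v y) ≤ S :=
    (ae_restrict_iff' measurableSet_Ioo).1 (ENNReal.ae_le_essSup _)
  refine lapCompact_of_vanishing hlam hq hv hvpos (W := max 1 (a ^ (-(lam / q)) * S.toReal)) ?_ hvan
  filter_upwards [hab, ae_restrict_of_ae hSae, ae_restrict_mem measurableSet_Ioi] with y hy hyS hy0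
  by_cases hyab : y ∈ Icc a b
  · refine le_trans ?_ (le_max_right _ _)
    have h2 : v y ≤ S.toReal :=
      (ENNReal.ofReal_le_iff_le_toReal hStop).1 (hyS ⟨hy0, hyab.2.trans_lt hTb⟩)
    exact mul_le_mul (Real.rpow_le_rpow_of_nonpos ha hyab.1 (by linarith)) h2 (hvpos y)
      (by positivity)
  · exact (hy hyab).trans (le_max_left _ _)

theorem stmt10 (lam q : ℝ) (hlam : 0 < lam) (hq : 1 ≤ q)
    (v : ℝ → ℝ) (hv : Measurable v) (hvpos : ∀ y, 0 ≤ v y)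
    (Bb : ℝ → ℝ≥0∞)
    -- `B̄(t) = t^{-λ/q} v̄₀(t)`, where `v̄₀(t) = ess sup_{0<x<t} v(x)`
    (hBb : Bb = fun t => (ENNReal.ofReal t) ^ (-(lam/q)) *
      essSup (fun x => ENNReal.ofReal (v x)) (volume.restrict (Ioo (0:ℝ) t))) :
    LapCompact lam 1 q v ↔
      essSup Bb (volume.restrict (Ioi (0:ℝ))) < ⊤
        ∧ Tendsto Bb (nhdsWithin 0 (Ioi 0)) (nhds 0)
        ∧ Tendsto Bb atTop (nhds 0) := by
  have hB : Bb = normalizedEssSup (lam / q) v := hBb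
  rw [hB]
  exact ⟨conditions_of_lapCompact hlam hq hv,
    fun h => lapCompact_of_tendsto hlam hq hv hvpos h.2.1 h.2.2⟩
end
end

section
/- Let λ>0 and 1<p≤q<∞, and let v,w be non-negative measurable weights on (0,∞) with v^{p'} and w^q locally integrable. Define A_H(t)=(∫_0^t v^{p'})^{1/p'} (∫_t^∞ x^{−λq} w(x)^q dx)^{1/q} and A_{H*}(t)=(∫_t^∞ y^{−λp'} v(y)^{p'} dy)^{1/p'} (∫_0^t w^q)^{1/q}. Then the Stieltjes-type operator S is bounded from L^p to L^q if and only if sup_{t>0} A_H(t) + sup_{t>0} A_{H*}(t) < ∞; moreover there exist constants 0<c₁≤c₂<∞ depending only on p, q and λ such that c₁(sup_{t>0} A_H(t)+sup_{t>0} A_{H*}(t)) ≤ ‖S‖_{L^p→L^q} ≤ c₂(sup_{t>0} A_H(t)+sup_{t>0} A_{H*}(t)). -/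
open MeasureTheory Set Filter Topology
open scoped ENNReal NNReal

noncomputable section

/-- The least constant `C` (possibly `∞`) such that `‖Sf‖_q ≤ C ‖f‖_p` for all measurable
`f ≥ 0`, where `Sf(x) = w(x) ∫_0^∞ f(y) v(y)/(x^λ + y^λ) dy` is the Stieltjes-type operator. -/
def SNorm (lam p q : ℝ) (v w : ℝ → ℝ) : ℝ≥0∞ :=
  sInf {c : ℝ≥0∞ | ∀ f : ℝ → ℝ, Measurable f → (∀ y, 0 ≤ f y) →
    (∫⁻ x in Ioi (0:ℝ), (ENNReal.ofReal (w x) * ∫⁻ y in Ioi (0:ℝ),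
        ENNReal.ofReal (f y) * ENNReal.ofReal (v y)
          / (ENNReal.ofReal (x ^ lam) + ENNReal.ofReal (y ^ lam))) ^ q) ^ (1/q)
      ≤ c * (∫⁻ y in Ioi (0:ℝ), ENNReal.ofReal (f y) ^ p) ^ (1/p)}

/-- `V₀(t) = ∫_0^t v^{p'}`. -/
def V0 (p' : ℝ) (v : ℝ → ℝ) (t : ℝ) : ℝ≥0∞ :=
  ∫⁻ y in Ioo (0:ℝ) t, ENNReal.ofReal (v y) ^ p'

/-- `𝒱_t(∞) = ∫_t^∞ y^{-λp'} v(y)^{p'} dy`. -/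
def Vinf (lam p' : ℝ) (v : ℝ → ℝ) (t : ℝ) : ℝ≥0∞ :=
  ∫⁻ y in Ioi t, (ENNReal.ofReal y) ^ (-(lam * p')) * ENNReal.ofReal (v y) ^ p'

/-- `W₀(t) = ∫_0^t w^q`. -/
def W0 (q : ℝ) (w : ℝ → ℝ) (t : ℝ) : ℝ≥0∞ :=
  ∫⁻ x in Ioo (0:ℝ) t, ENNReal.ofReal (w x) ^ q

/-- `𝒲_t(∞) = ∫_t^∞ x^{-λq} w(x)^q dx`. -/
def Winf (lam q : ℝ) (w : ℝ → ℝ) (t : ℝ) : ℝ≥0∞ :=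
  ∫⁻ x in Ioi t, (ENNReal.ofReal x) ^ (-(lam * q)) * ENNReal.ofReal (w x) ^ q

/-- `A_H(t) = (∫_0^t v^{p'})^{1/p'} (∫_t^∞ x^{-λq} w(x)^q dx)^{1/q}`. -/
def AH (lam p' q : ℝ) (v w : ℝ → ℝ) (t : ℝ) : ℝ≥0∞ :=
  (V0 p' v t) ^ (1/p') * (Winf lam q w t) ^ (1/q)

/-- `A_{H*}(t) = (∫_t^∞ y^{-λp'} v(y)^{p'} dy)^{1/p'} (∫_0^t w^q)^{1/q}`. -/
def AHs (lam p' q : ℝ) (v w : ℝ → ℝ) (t : ℝ) : ℝ≥0∞ :=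
  (Vinf lam p' v t) ^ (1/p') * (W0 q w t) ^ (1/q)

lemma ENNReal.mul_rpow_sub_one (b : ℝ≥0∞) {r : ℝ} (hr : 1 ≤ r) : b * b ^ (r - 1) = b ^ r := by
  have h := ENNReal.rpow_add_of_nonneg (x := b) 1 (r - 1) zero_le_one (by linarith)
  rw [ENNReal.rpow_one, add_sub_cancel] at h
  exact h.symm

/-- The `ℓ¹` norm dominates the `ℓ^r` norm for `r ≥ 1`. -/
lemma ENNReal.tsum_rpow_le_rpow_tsum {ι : Type*} (a : ι → ℝ≥0∞) {r : ℝ} (hr : 1 ≤ r) :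
    ∑' i, a i ^ r ≤ (∑' i, a i) ^ r := by
  rw [← ENNReal.mul_rpow_sub_one (∑' i, a i) hr, ← ENNReal.tsum_mul_right]
  refine ENNReal.tsum_le_tsum fun i => ?_
  rw [← ENNReal.mul_rpow_sub_one (a i) hr]
  have := sub_nonneg.2 hr
  gcongr
  exact ENNReal.le_tsum i

lemma setLIntegral_Iio_le_add_edist {g : ℝ → ℝ≥0∞} {M : ℝ≥0∞} (hM : ∀ y, g y ≤ M) (x y : ℝ) :
    ∫⁻ s in Iio x, g s ≤ (∫⁻ s in Iio y, g s) + M * edist x y := by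
  have hsub : Iio x ⊆ Iio y ∪ Ico y x := fun s hs => by
    rcases lt_or_ge s y with h | h
    · exact Or.inl h
    · exact Or.inr ⟨h, hs⟩
  calc ∫⁻ s in Iio x, g s ≤ ∫⁻ s in Iio y ∪ Ico y x, g s := lintegral_mono_set hsub
    _ ≤ (∫⁻ s in Iio y, g s) + ∫⁻ s in Ico y x, g s := lintegral_union_le _ _ _
    _ ≤ (∫⁻ s in Iio y, g s) + ∫⁻ _ in Ico y x, M := by gcongr; exact hM _
    _ ≤ _ := by
      rw [setLIntegral_const, Real.volume_Ico, edist_dist, Real.dist_eq]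
      gcongr
      exact le_abs_self _

/-- A bounded function vanishing near `-∞` satisfies the weighted Hardy inequality. -/
lemma hardy_of_bounded {p p' q : ℝ} (hpp : p.HolderConjugate p') (hpq : p ≤ q)
    {f v u g : ℝ → ℝ≥0∞} (hf : Measurable f) (hv : Measurable v) (hu : Measurable u)
    {A M : ℝ≥0∞}
    (hA : ∀ t, (∫⁻ y in Iio t, v y ^ p') ^ (1/p') * (∫⁻ x in Ioi t, u x ^ q) ^ (1/q) ≤ A)
    (hgfv : ∀ y, g y ≤ f y * v y) (hM : M ≠ ⊤) (hgM : ∀ y, g y ≤ M) {x₀ : ℝ}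
    (hx₀ : ∀ y < x₀, g y = 0) :
    (∫⁻ x, (u x * ∫⁻ y in Iio x, g y) ^ q) ^ (1/q) ≤ 8 * A * (∫⁻ y, f y ^ p) ^ (1/p) := by
  have hp0 : 0 < p := hpp.pos
  have hq0 : 0 < q := hp0.trans_le hpq
  set F : ℝ → ℝ≥0∞ := fun x => ∫⁻ y in Iio x, g y with hF
  have hFmono : Monotone F := fun a b hab => lintegral_mono_set (Iio_subset_Iio hab)
  have hFcont : Continuous F :=
    continuous_of_le_add_edist M hM fun x y => setLIntegral_Iio_le_add_edist hgM x y
  have hF0 : F x₀ = 0 := by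
    simp only [hF]
    rw [setLIntegral_congr_fun measurableSet_Iio (g := 0) (fun y hy => hx₀ y hy)]
    simp
  have hFtop : ∀ x, F x ≠ ⊤ := fun x => by
    refine ne_top_of_le_ne_top ?_ (setLIntegral_Iio_le_add_edist hgM x x₀)
    change F x₀ + _ ≠ ⊤
    rw [hF0, zero_add]
    exact ENNReal.mul_ne_top hM (edist_ne_top _ _)
  set E : ℤ → Set ℝ := fun k => F ⁻¹' Ico ((2:ℝ≥0∞) ^ k) (2 ^ (k + 1)) with hE
  have hEmeas : ∀ k, MeasurableSet (E k) := fun k => hFcont.measurable measurableSet_Ico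
  have h2 : ∀ k : ℤ, (2:ℝ≥0∞) ^ (k + 1) = 2 ^ k * 2 := fun k => by
    rw [ENNReal.zpow_add (by simp) (by simp), zpow_one]
  have h2top : ∀ k : ℤ, (2:ℝ≥0∞) ^ k ≠ ⊤ := fun k =>
    ENNReal.zpow_ne_top (by simp) (by simp) _
  have hEdisj : Pairwise (Function.onFun Disjoint E) := by
    have hmono : Monotone fun k : ℤ => (2:ℝ≥0∞) ^ k := fun a b h =>
      ENNReal.zpow_le_of_le (by norm_num) h
    intro i j hij
    refine Disjoint.preimage _ ?_
    simpa using hmono.pairwise_disjoint_on_Ico_succ hij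
  have hcover : ∀ x, (u x * F x) ^ q ≤ (⋃ k, E k).indicator (fun x => (u x * F x) ^ q) x := by
    intro x
    by_cases hx : F x = 0
    · simp [hx, hq0]
    · obtain ⟨k, hk⟩ := ENNReal.exists_mem_Ico_zpow hx (hFtop x) (by norm_num : (1:ℝ≥0∞) < 2)
        (by simp)
      rw [indicator_of_mem (mem_iUnion.2 ⟨k, hk⟩)]
  have hpiece : ∀ k : ℤ, ∫⁻ x in E (k + 1), (u x * F x) ^ q
      ≤ (8 * A) ^ q * (∫⁻ y in E k, f y ^ p) ^ (q / p) := by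
    intro k
    rcases (E (k + 1)).eq_empty_or_nonempty with hemp | ⟨x, hx⟩
    · simp [hemp]
    have hxk : (2:ℝ≥0∞) ^ k * 2 ≤ F x := by rw [← h2]; exact hx.1
    have hIVT : ∀ c, c ≤ (2:ℝ≥0∞) ^ k * 2 → ∃ a, F a = c := fun c hc =>
      mem_range_of_exists_le_of_exists_ge hFcont ⟨x₀, hF0.le.trans zero_le⟩ ⟨x, hc.trans hxk⟩
    obtain ⟨a, ha⟩ := hIVT (2 ^ k) (by rw [mul_two]; exact le_self_add)
    have h32 : (2:ℝ≥0∞) ^ k + 2 ^ k / 2 < 2 ^ k * 2 := by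
      rw [mul_two]
      exact ENNReal.add_lt_add_left (h2top k)
        (ENNReal.half_lt_self (ENNReal.zpow_pos (by simp) (by simp) _).ne' (h2top k))
    obtain ⟨b, hb⟩ := hIVT (2 ^ k + 2 ^ k / 2) h32.le
    have hab : Ico a b ⊆ E k := fun y hy =>
      ⟨ha ▸ hFmono hy.1, (hFmono hy.2.le).trans_lt (by rw [hb, h2]; exact h32)⟩
    have hbE : E (k + 1) ⊆ Ioi b := fun y hy => by
      by_contra hyb
      have := hFmono (not_lt.1 hyb)
      rw [hb] at this
      have h3 := hy.1
      rw [h2] at h3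
      exact absurd (h3.trans this) (not_le.2 h32)
    have hlow : (2:ℝ≥0∞) ^ k / 2 ≤ ∫⁻ y in Ico a b, g y := by
      have hFb : F b ≤ F a + ∫⁻ y in Ico a b, g y := by
        refine le_trans (lintegral_mono_set fun s hs => ?_) (lintegral_union_le _ _ _)
        rcases lt_or_ge s a with h | h
        · exact Or.inl h
        · exact Or.inr ⟨h, hs⟩
      rw [ha, hb] at hFb
      exact (ENNReal.add_le_add_iff_left (h2top k)).1 hFb
    have hhold : ∫⁻ y in Ico a b, g y
        ≤ (∫⁻ y in E k, f y ^ p) ^ (1/p) * (∫⁻ y in Iio b, v y ^ p') ^ (1/p') := by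
      calc ∫⁻ y in Ico a b, g y ≤ ∫⁻ y in Ico a b, (f * v) y := lintegral_mono fun y => hgfv y
        _ ≤ (∫⁻ y in Ico a b, f y ^ p) ^ (1/p) * (∫⁻ y in Ico a b, v y ^ p') ^ (1/p') :=
          ENNReal.lintegral_mul_le_Lp_mul_Lq _ hpp hf.aemeasurable hv.aemeasurable
        _ ≤ _ := by
          have h1 : 0 ≤ 1/p := by positivity
          have h1' : 0 ≤ 1/p' := one_div_nonneg.2 hpp.symm.nonneg
          gcongr
          exact Ico_subset_Iio_self
    have hU : (2:ℝ≥0∞) ^ k / 2 * (∫⁻ x in E (k + 1), u x ^ q) ^ (1/q)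
        ≤ (∫⁻ y in E k, f y ^ p) ^ (1/p) * A := by
      have h1 : 0 ≤ 1/q := by positivity
      calc _ ≤ ((∫⁻ y in E k, f y ^ p) ^ (1/p) * (∫⁻ y in Iio b, v y ^ p') ^ (1/p'))
            * (∫⁻ x in Ioi b, u x ^ q) ^ (1/q) := by
            gcongr
            exact hlow.trans hhold
        _ ≤ _ := by rw [mul_assoc]; gcongr; exact hA b
    have h8 : (2:ℝ≥0∞) ^ (k + 1 + 1) = 8 * (2 ^ k / 2) := by
      rw [h2, h2, ENNReal.div_eq_inv_mul, ← mul_assoc,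
        show (8:ℝ≥0∞) = 4 * 2 by norm_num, mul_assoc 4,
        ENNReal.mul_inv_cancel (by simp) (by simp), mul_one, mul_assoc, mul_comm]
      norm_num
    calc ∫⁻ x in E (k + 1), (u x * F x) ^ q
        ≤ ∫⁻ x in E (k + 1), (2 ^ (k + 1 + 1)) ^ q * u x ^ q := by
          refine setLIntegral_mono' (hEmeas _) fun x hx => ?_
          rw [ENNReal.mul_rpow_of_nonneg _ _ hq0.le, mul_comm]
          gcongr
          exact hx.2.le
      _ = (8 * (2 ^ k / 2 * (∫⁻ x in E (k + 1), u x ^ q) ^ (1/q))) ^ q := by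
          rw [lintegral_const_mul _ (hu.pow_const q), h8, ← mul_assoc,
            ENNReal.mul_rpow_of_nonneg _ (_ ^ (1/q)) hq0.le, ← ENNReal.rpow_mul,
            one_div_mul_cancel hq0.ne', ENNReal.rpow_one]
      _ ≤ (8 * ((∫⁻ y in E k, f y ^ p) ^ (1/p) * A)) ^ q := by gcongr
      _ = _ := by
          rw [mul_comm _ A, ← mul_assoc, ENNReal.mul_rpow_of_nonneg _ _ hq0.le,
            ← ENNReal.rpow_mul, one_div_mul_eq_div]
  have hmain : ∫⁻ x, (u x * F x) ^ q ≤ (8 * A) ^ q * (∫⁻ y, f y ^ p) ^ (q / p) := by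
    calc ∫⁻ x, (u x * F x) ^ q ≤ ∫⁻ x in ⋃ k, E k, (u x * F x) ^ q := by
          rw [← lintegral_indicator (MeasurableSet.iUnion hEmeas)]
          exact lintegral_mono hcover
      _ ≤ ∑' k, ∫⁻ x in E k, (u x * F x) ^ q := lintegral_iUnion_le _ _
      _ = ∑' k, ∫⁻ x in E (k + 1), (u x * F x) ^ q :=
          ((Equiv.addRight (1:ℤ)).tsum_eq fun k => ∫⁻ x in E k, (u x * F x) ^ q).symm
      _ ≤ ∑' k, (8 * A) ^ q * (∫⁻ y in E k, f y ^ p) ^ (q / p) := ENNReal.tsum_le_tsum hpiece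
      _ ≤ (8 * A) ^ q * (∑' k, ∫⁻ y in E k, f y ^ p) ^ (q / p) := by
          rw [ENNReal.tsum_mul_left]
          gcongr
          exact ENNReal.tsum_rpow_le_rpow_tsum _ ((one_le_div hp0).2 hpq)
      _ ≤ _ := by
          rw [← lintegral_iUnion hEmeas hEdisj]
          gcongr
          exact Measure.restrict_le_self
  calc _ ≤ ((8 * A) ^ q * (∫⁻ y, f y ^ p) ^ (q / p)) ^ (1/q) := by gcongr
    _ = _ := by
      rw [ENNReal.mul_rpow_of_nonneg _ _ (by positivity), ← ENNReal.rpow_mul, ← ENNReal.rpow_mul,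
        mul_one_div_cancel hq0.ne', ENNReal.rpow_one]
      congr 2
      field_simp

/-- Weighted Hardy inequality on the line. -/
lemma hardy_Iio {p p' q : ℝ} (hpp : p.HolderConjugate p') (hpq : p ≤ q)
    {f v u : ℝ → ℝ≥0∞} (hf : Measurable f) (hv : Measurable v) (hu : Measurable u) {A : ℝ≥0∞}
    (hA : ∀ t, (∫⁻ y in Iio t, v y ^ p') ^ (1/p') * (∫⁻ x in Ioi t, u x ^ q) ^ (1/q) ≤ A) :
    (∫⁻ x, (u x * ∫⁻ y in Iio x, f y * v y) ^ q) ^ (1/q)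
      ≤ 8 * A * (∫⁻ y, f y ^ p) ^ (1/p) := by
  have hq0 : 0 < q := hpp.pos.trans_le hpq
  set g : ℕ → ℝ → ℝ≥0∞ := fun n => (Ici (-(n:ℝ))).indicator fun y => min (f y * v y) n with hg
  have hgm : ∀ n, Measurable (g n) := fun n =>
    ((hf.mul hv).min measurable_const).indicator measurableSet_Ici
  have hgmono : Monotone g := by
    intro m n hmn y
    have hmn' : (m:ℝ) ≤ n := by exact_mod_cast hmn
    refine (indicator_le_indicator_of_subset (Ici_subset_Ici.2 (neg_le_neg hmn'))
      (fun _ => zero_le) y).trans (indicator_le_indicator ?_)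
    gcongr
  have hgsup : ∀ y, ⨆ n, g n y = f y * v y := by
    intro y
    refine le_antisymm (iSup_le fun n => ?_) ?_
    · exact indicator_le_self' (fun _ _ => zero_le) y |>.trans (min_le_left _ _)
    · refine le_of_forall_lt fun c hc => ?_
      obtain ⟨n, hn⟩ := ENNReal.exists_nat_gt hc.ne_top
      obtain ⟨m, hm⟩ := exists_nat_ge (-y)
      refine lt_of_lt_of_le ?_ (le_iSup _ (max n m))
      have hmem : y ∈ Ici (-((max n m : ℕ):ℝ)) := by
        have : (m:ℝ) ≤ (max n m : ℕ) := by exact_mod_cast le_max_right _ _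
        exact mem_Ici.2 (by linarith)
      simp only [hg]
      rw [indicator_of_mem hmem]
      exact lt_min hc (hn.trans_le (by exact_mod_cast le_max_left _ _))
  have hmeasF : ∀ n, Measurable fun x => (u x * ∫⁻ y in Iio x, g n y) ^ q := fun n =>
    (hu.mul (Monotone.measurable fun a b hab =>
      lintegral_mono_set (Iio_subset_Iio hab))).pow_const q
  have hlim : ∫⁻ x, (u x * ∫⁻ y in Iio x, f y * v y) ^ q
      = ⨆ n, ∫⁻ x, (u x * ∫⁻ y in Iio x, g n y) ^ q := by
    rw [← lintegral_iSup hmeasF]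
    · refine lintegral_congr fun x => ?_
      simp_rw [← hgsup]
      rw [lintegral_iSup hgm hgmono, ENNReal.mul_iSup]
      exact (ENNReal.orderIsoRpow q hq0).map_iSup _
    · intro m n hmn x
      dsimp only
      gcongr
      exact hgmono hmn _
  rw [hlim, one_div, ENNReal.rpow_inv_le_iff hq0]
  refine iSup_le fun n => ?_
  rw [← ENNReal.rpow_inv_le_iff hq0, ← one_div]
  exact hardy_of_bounded hpp hpq hf hv hu hA
    (fun y => (indicator_le_self' (fun _ _ => zero_le) y).trans (min_le_left _ _))
    (ENNReal.natCast_ne_top n)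
    (fun y => (indicator_le_self' (fun _ _ => zero_le) y).trans (min_le_right _ _))
    (x₀ := -(n:ℝ)) (fun y hy => indicator_of_notMem (notMem_Ici.2 hy) _)

lemma setLIntegral_Iio_neg (h : ℝ → ℝ≥0∞) (t : ℝ) :
    ∫⁻ y in Iio t, h (-y) = ∫⁻ y in Ioi (-t), h y := by
  have := (Measure.measurePreserving_neg (volume : Measure ℝ)).setLIntegral_comp_preimage_emb
    (MeasurableEquiv.neg ℝ).measurableEmbedding h (Ioi (-t))
  rw [← this]
  simp

lemma setLIntegral_Ioi_neg (h : ℝ → ℝ≥0∞) (t : ℝ) :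
    ∫⁻ y in Ioi t, h (-y) = ∫⁻ y in Iio (-t), h y := by
  simpa using (setLIntegral_Iio_neg (fun y => h (-y)) (-t)).symm

/-- The dual weighted Hardy inequality on the line. -/
lemma hardy_Ioi {p p' q : ℝ} (hpp : p.HolderConjugate p') (hpq : p ≤ q)
    {f v u : ℝ → ℝ≥0∞} (hf : Measurable f) (hv : Measurable v) (hu : Measurable u) {A : ℝ≥0∞}
    (hA : ∀ t, (∫⁻ y in Ioi t, v y ^ p') ^ (1/p') * (∫⁻ x in Iio t, u x ^ q) ^ (1/q) ≤ A) :
    (∫⁻ x, (u x * ∫⁻ y in Ioi x, f y * v y) ^ q) ^ (1/q)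
      ≤ 8 * A * (∫⁻ y, f y ^ p) ^ (1/p) := by
  have h := hardy_Iio hpp hpq (hf.comp measurable_neg) (hv.comp measurable_neg)
    (hu.comp measurable_neg) (A := A) fun t => by
      simp only [Function.comp_def]
      rw [setLIntegral_Iio_neg (fun y => v y ^ p'), setLIntegral_Ioi_neg (fun y => u y ^ q)]
      exact hA (-t)
  simp only [Function.comp_def] at h
  simp_rw [setLIntegral_Iio_neg (fun y => f y * v y)] at h
  rwa [lintegral_neg_eq_self (fun x => (u x * ∫⁻ y in Ioi x, f y * v y) ^ q),
    lintegral_neg_eq_self (fun y => f y ^ p)] at h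


/-- A lower bound for the norm of a functional on `L^p`, tested on non-negative functions. -/
lemma rpow_lintegral_mul_le_of_forall {p p' : ℝ} (hpp : p.HolderConjugate p') {ψ : ℝ → ℝ}
    (hψ : Measurable ψ) (hψ0 : ∀ y, 0 ≤ ψ y) {D : Set ℝ} (hD : MeasurableSet D) {K C : ℝ≥0∞}
    (h : ∀ f : ℝ → ℝ, Measurable f → (∀ y, 0 ≤ f y) → (∀ y ∉ D, f y = 0) →
      K * ∫⁻ y in D, ENNReal.ofReal (f y) * ENNReal.ofReal (ψ y)
        ≤ C * (∫⁻ y in D, ENNReal.ofReal (f y) ^ p) ^ (1/p)) :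
    (∫⁻ y in D, ENNReal.ofReal (ψ y) ^ p') ^ (1/p') * K ≤ C := by
  have hp0 : 0 < p := hpp.pos
  have hp'0 : 0 < p' := hpp.symm.pos
  have hp'1 : 1 < p' := hpp.symm.lt
  set B : ℕ → Set ℝ := fun n => D ∩ ({y | ψ y ≤ n} ∩ Icc (-(n:ℝ)) n) with hB
  have hBm : ∀ n, MeasurableSet (B n) := fun n =>
    hD.inter ((measurableSet_le hψ measurable_const).inter measurableSet_Icc)
  have hBmono : Monotone B := by
    intro m n hmn y hy
    have hmn' : (m:ℝ) ≤ n := by exact_mod_cast hmn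
    exact ⟨hy.1, le_trans hy.2.1 hmn', by linarith [hy.2.2.1], hy.2.2.2.trans hmn'⟩
  have hBU : ⋃ n, B n = D := by
    refine Subset.antisymm (iUnion_subset fun n => inter_subset_left) fun y hy => ?_
    obtain ⟨n, hn⟩ := exists_nat_ge (max (ψ y) |y|)
    have h1 := (le_max_right _ _).trans hn
    exact mem_iUnion.2 ⟨n, hy, (le_max_left _ _).trans hn, abs_le.1 h1⟩
  have hsup : ∫⁻ y in D, ENNReal.ofReal (ψ y) ^ p'
      = ⨆ n, ∫⁻ y in B n, ENNReal.ofReal (ψ y) ^ p' := by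
    rw [← setLIntegral_iUnion_of_directed _ hBmono.directed_le, hBU]
  have hstep : ∀ n, (∫⁻ y in B n, ENNReal.ofReal (ψ y) ^ p') ^ (1/p') * K ≤ C := by
    intro n
    set M := ∫⁻ y in B n, ENNReal.ofReal (ψ y) ^ p' with hM
    have hMtop : M ≠ ⊤ := by
      refine ne_top_of_le_ne_top ?_ (setLIntegral_mono' (hBm n)
        (g := fun _ => ENNReal.ofReal n ^ p') fun y hy => ?_)
      · rw [setLIntegral_const]
        refine ENNReal.mul_ne_top (by simp [hp'0.le]) (ne_top_of_le_ne_top ?_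
          (measure_mono fun y hy => hy.2.2))
        simp
      · gcongr
        exact hy.2.1
    have hfm : Measurable ((B n).indicator fun y => ψ y ^ (p' - 1)) :=
      (hψ.pow_const _).indicator (hBm n)
    have hinter : B n ∩ D = B n := inter_eq_left.2 inter_subset_left
    have hmul : ∫⁻ y in D, ENNReal.ofReal ((B n).indicator (fun y => ψ y ^ (p' - 1)) y)
        * ENNReal.ofReal (ψ y) = M := by
      rw [hM, ← hinter, ← setLIntegral_indicator (hBm n), hinter]
      refine lintegral_congr fun y => ?_
      by_cases hy : y ∈ B n
      · simp only [indicator_of_mem hy]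
        rw [← ENNReal.ofReal_rpow_of_nonneg (hψ0 y) (by linarith), mul_comm,
          ENNReal.mul_rpow_sub_one _ hp'1.le]
      · simp [hy]
    have hpow : ∫⁻ y in D, ENNReal.ofReal ((B n).indicator (fun y => ψ y ^ (p' - 1)) y) ^ p
        = M := by
      rw [hM, ← hinter, ← setLIntegral_indicator (hBm n), hinter]
      refine lintegral_congr fun y => ?_
      by_cases hy : y ∈ B n
      · simp only [indicator_of_mem hy]
        rw [← ENNReal.ofReal_rpow_of_nonneg (hψ0 y) (by linarith), ← ENNReal.rpow_mul,
          hpp.symm.sub_one_mul_conj]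
      · simp [hy, hp0]
    have key := h _ hfm
      (fun y => indicator_nonneg (fun y _ => Real.rpow_nonneg (hψ0 y) _) y)
      (fun y hy => indicator_of_notMem (fun hy' => hy hy'.1) _)
    rw [hmul, hpow] at key
    rcases eq_or_ne M 0 with h0 | h0
    · simp [h0, hp'0]
    have hsplit : M = M ^ (1/p') * M ^ (1/p) := by
      rw [← ENNReal.rpow_add _ _ h0 hMtop, one_div, one_div, add_comm, hpp.inv_add_inv_eq_one,
        ENNReal.rpow_one]
    have hMp0 : M ^ (1/p) ≠ 0 := by simp [h0, hMtop]
    have hMpt : M ^ (1/p) ≠ ⊤ := ENNReal.rpow_ne_top_of_nonneg (by positivity) hMtop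
    refine (ENNReal.mul_le_mul_iff_left hMp0 hMpt).1 ?_
    calc M ^ (1/p') * K * M ^ (1/p) = K * (M ^ (1/p') * M ^ (1/p)) := by ring
      _ ≤ _ := by rw [← hsplit]; exact key
  have h1 : (⨆ n, ∫⁻ y in B n, ENNReal.ofReal (ψ y) ^ p') ^ (1/p')
      = ⨆ n, (∫⁻ y in B n, ENNReal.ofReal (ψ y) ^ p') ^ (1/p') :=
    (ENNReal.orderIsoRpow (1/p') (by positivity)).map_iSup _
  rw [hsup, h1, ENNReal.iSup_mul]
  exact iSup_le hstep

/-- Lower bound for `SNorm` from a product minorant of the kernel on a rectangle `G × D`. -/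
lemma le_two_mul_SNorm {lam p p' q : ℝ} (hpp : p.HolderConjugate p') (hq0 : 0 < q)
    {v w ψ : ℝ → ℝ} {φ : ℝ → ℝ≥0∞} (hv : Measurable v) (hψ : Measurable ψ) (hψ0 : ∀ y, 0 ≤ ψ y)
    (hφ : Measurable φ) {D G : Set ℝ} (hD : MeasurableSet D) (hG : MeasurableSet G)
    (hD0 : D ⊆ Ioi 0) (hG0 : G ⊆ Ioi 0)
    (hker : ∀ x ∈ G, ∀ y ∈ D, φ x * ENNReal.ofReal (ψ y) ≤ 2 * (ENNReal.ofReal (w x) *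
      (ENNReal.ofReal (v y) / (ENNReal.ofReal (x ^ lam) + ENNReal.ofReal (y ^ lam))))) :
    (∫⁻ y in D, ENNReal.ofReal (ψ y) ^ p') ^ (1/p') * (∫⁻ x in G, φ x ^ q) ^ (1/q)
      ≤ 2 * SNorm lam p q v w := by
  have hp0 : 0 < p := hpp.pos
  rw [mul_comm 2, ← ENNReal.div_le_iff two_ne_zero ENNReal.ofNat_ne_top]
  refine le_sInf fun c hc => ?_
  rw [ENNReal.div_le_iff two_ne_zero ENNReal.ofNat_ne_top]
  refine rpow_lintegral_mul_le_of_forall hpp hψ hψ0 hD fun f hf hf0 hfD => ?_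
  have hcf := hc f hf hf0
  have hnorm : ∫⁻ y in Ioi (0:ℝ), ENNReal.ofReal (f y) ^ p = ∫⁻ y in D, ENNReal.ofReal (f y) ^ p := by
    rw [← inter_eq_left.2 hD0, ← setLIntegral_indicator hD]
    refine lintegral_congr fun y => ?_
    by_cases hy : y ∈ D <;> simp [hy, hfD, hp0]
  set J := ∫⁻ y in D, ENNReal.ofReal (f y) * ENNReal.ofReal (ψ y) with hJ
  rw [hnorm] at hcf
  set S : ℝ → ℝ≥0∞ := fun x => ENNReal.ofReal (w x) * ∫⁻ y in Ioi (0:ℝ),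
    ENNReal.ofReal (f y) * ENNReal.ofReal (v y)
      / (ENNReal.ofReal (x ^ lam) + ENNReal.ofReal (y ^ lam)) with hS
  have hpt : ∀ x ∈ G, φ x * J ≤ 2 * S x := by
    intro x hx
    have hm : Measurable fun y => ENNReal.ofReal (f y) * ENNReal.ofReal (ψ y) := by fun_prop
    have hm' : Measurable fun y => ENNReal.ofReal (f y) * ENNReal.ofReal (v y)
      / (ENNReal.ofReal (x ^ lam) + ENNReal.ofReal (y ^ lam)) := by fun_prop
    calc φ x * J = ∫⁻ y in D, φ x * (ENNReal.ofReal (f y) * ENNReal.ofReal (ψ y)) :=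
          (lintegral_const_mul _ hm).symm
      _ ≤ ∫⁻ y in D, 2 * ENNReal.ofReal (w x) * (ENNReal.ofReal (f y) * ENNReal.ofReal (v y)
            / (ENNReal.ofReal (x ^ lam) + ENNReal.ofReal (y ^ lam))) := by
          refine setLIntegral_mono' hD fun y hy => ?_
          calc _ = ENNReal.ofReal (f y) * (φ x * ENNReal.ofReal (ψ y)) := by ring
            _ ≤ _ := mul_le_mul_right (hker x hx y hy) _
            _ = _ := by simp only [div_eq_mul_inv]; ring
      _ ≤ ∫⁻ y in Ioi (0:ℝ), 2 * ENNReal.ofReal (w x) *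
            (ENNReal.ofReal (f y) * ENNReal.ofReal (v y)
            / (ENNReal.ofReal (x ^ lam) + ENNReal.ofReal (y ^ lam))) := lintegral_mono_set hD0
      _ = 2 * S x := by rw [lintegral_const_mul _ hm', mul_assoc]
  calc (∫⁻ x in G, φ x ^ q) ^ (1/q) * J = (∫⁻ x in G, (φ x * J) ^ q) ^ (1/q) := by
        simp_rw [ENNReal.mul_rpow_of_nonneg _ _ hq0.le]
        rw [lintegral_mul_const _ (hφ.pow_const q),
          ENNReal.mul_rpow_of_nonneg _ _ (by positivity), ← ENNReal.rpow_mul J,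
          mul_one_div_cancel hq0.ne', ENNReal.rpow_one]
    _ ≤ (∫⁻ x in G, (2 * S x) ^ q) ^ (1/q) := by
        have h1 : 0 ≤ 1/q := by positivity
        refine ENNReal.rpow_le_rpow (setLIntegral_mono' hG fun x hx => ?_) h1
        exact ENNReal.rpow_le_rpow (hpt x hx) hq0.le
    _ ≤ (∫⁻ x in Ioi (0:ℝ), (2 * S x) ^ q) ^ (1/q) := by gcongr
    _ = 2 * (∫⁻ x in Ioi (0:ℝ), S x ^ q) ^ (1/q) := by
        simp_rw [ENNReal.mul_rpow_of_nonneg _ _ hq0.le]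
        rw [lintegral_const_mul' _ _ (by simp),
          ENNReal.mul_rpow_of_nonneg _ _ (by positivity), ← ENNReal.rpow_mul 2,
          mul_one_div_cancel hq0.ne', ENNReal.rpow_one]
    _ ≤ 2 * (c * (∫⁻ y in D, ENNReal.ofReal (f y) ^ p) ^ (1/p)) := by gcongr
    _ = _ := by ring

lemma ENNReal.inv_le_two_mul_inv_add {X Y : ℝ≥0∞} (h : Y ≤ X) : X⁻¹ ≤ 2 * (X + Y)⁻¹ := by
  calc X⁻¹ = 2 * (2 * X)⁻¹ := by
        rw [ENNReal.mul_inv (by simp) (by simp), ← mul_assoc,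
          ENNReal.mul_inv_cancel (by simp) (by simp), one_mul]
    _ ≤ _ := by rw [two_mul X]; gcongr

lemma ENNReal.ofReal_rpow_neg_eq_inv {x : ℝ} (hx : 0 < x) (lam : ℝ) :
    ENNReal.ofReal x ^ (-lam) = (ENNReal.ofReal (x ^ lam))⁻¹ := by
  rw [ENNReal.rpow_neg, ENNReal.ofReal_rpow_of_pos hx]

lemma AH_le_two_mul_SNorm {lam p p' q : ℝ} (hlam : 0 < lam) (hpp : p.HolderConjugate p')
    (hq0 : 0 < q) {v w : ℝ → ℝ} (hv : Measurable v) (hw : Measurable w) (hv0 : ∀ y, 0 ≤ v y)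
    {t : ℝ} (ht : 0 < t) : AH lam p' q v w t ≤ 2 * SNorm lam p q v w := by
  have h := le_two_mul_SNorm (lam := lam) (w := w) hpp hq0 hv hv hv0
    (φ := fun x => ENNReal.ofReal x ^ (-lam) * ENNReal.ofReal (w x)) (by fun_prop)
    (D := Ioo 0 t) (G := Ioi t) measurableSet_Ioo measurableSet_Ioi (fun y hy => hy.1)
    (Ioi_subset_Ioi ht.le) ?_
  · refine le_trans (le_of_eq ?_) h
    simp only [AH, V0, Winf]
    simp_rw [ENNReal.mul_rpow_of_nonneg _ _ hq0.le, ← ENNReal.rpow_mul, neg_mul]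
  · intro x hx y hy
    have hyx : y ≤ x := hy.2.le.trans (mem_Ioi.1 hx).le
    rw [ENNReal.ofReal_rpow_neg_eq_inv (ht.trans hx)]
    calc _ = ENNReal.ofReal (w x) * ENNReal.ofReal (v y) * (ENNReal.ofReal (x ^ lam))⁻¹ := by ring
      _ ≤ _ := mul_le_mul_right (ENNReal.inv_le_two_mul_inv_add (ENNReal.ofReal_le_ofReal
          (Real.rpow_le_rpow hy.1.le hyx hlam.le))) _
      _ = _ := by simp only [div_eq_mul_inv]; ring

lemma AHs_le_two_mul_SNorm {lam p p' q : ℝ} (hlam : 0 < lam) (hpp : p.HolderConjugate p')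
    (hq0 : 0 < q) {v w : ℝ → ℝ} (hv : Measurable v) (hw : Measurable w) (hv0 : ∀ y, 0 ≤ v y)
    {t : ℝ} (ht : 0 < t) : AHs lam p' q v w t ≤ 2 * SNorm lam p q v w := by
  have hψ : ∀ y ∈ Ioi t, ENNReal.ofReal (|y| ^ (-lam) * v y)
      = ENNReal.ofReal y ^ (-lam) * ENNReal.ofReal (v y) := fun y hy => by
    have hy0 : 0 < y := ht.trans hy
    rw [ENNReal.ofReal_mul (by positivity), abs_of_pos hy0, ENNReal.ofReal_rpow_of_pos hy0]
  have h := le_two_mul_SNorm (lam := lam) (w := w) hpp hq0 hv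
    (ψ := fun y => |y| ^ (-lam) * v y) (by fun_prop)
    (fun y => mul_nonneg (by positivity) (hv0 y))
    (φ := fun x => ENNReal.ofReal (w x)) (by fun_prop)
    (D := Ioi t) (G := Ioo 0 t) measurableSet_Ioi measurableSet_Ioo
    (Ioi_subset_Ioi ht.le) (fun y hy => hy.1) ?_
  · refine le_trans (le_of_eq ?_) h
    simp only [AHs, Vinf, W0]
    congr 2
    refine setLIntegral_congr_fun measurableSet_Ioi fun y hy => ?_
    rw [hψ y hy, ENNReal.mul_rpow_of_nonneg _ _ hpp.symm.nonneg, ← ENNReal.rpow_mul, neg_mul]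
  · intro x hx y hy
    have hxy : x ≤ y := hx.2.le.trans (mem_Ioi.1 hy).le
    rw [hψ y hy, ENNReal.ofReal_rpow_neg_eq_inv (ht.trans hy)]
    calc _ = ENNReal.ofReal (w x) * ENNReal.ofReal (v y) * (ENNReal.ofReal (y ^ lam))⁻¹ := by ring
      _ ≤ _ := mul_le_mul_right (ENNReal.inv_le_two_mul_inv_add (ENNReal.ofReal_le_ofReal
          (Real.rpow_le_rpow hx.1.le hxy hlam.le))) _
      _ = _ := by simp only [div_eq_mul_inv]; rw [add_comm]; ring

lemma setLIntegral_indicator_rpow {S : Set ℝ} (hS : MeasurableSet S) (T : Set ℝ)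
    (g : ℝ → ℝ≥0∞) {r : ℝ} (hr : 0 < r) :
    ∫⁻ y in T, S.indicator g y ^ r = ∫⁻ y in S ∩ T, g y ^ r := by
  rw [← setLIntegral_indicator hS]
  refine lintegral_congr fun y => ?_
  by_cases hy : y ∈ S <;> simp [hy, hr]

lemma SNorm_le {lam p p' q : ℝ} (hpp : p.HolderConjugate p') (hpq : p ≤ q) {v w : ℝ → ℝ}
    (hv : Measurable v) (hw : Measurable w) :
    SNorm lam p q v w ≤ 8 * ((⨆ t ∈ Ioi (0:ℝ), AH lam p' q v w t)
      + ⨆ t ∈ Ioi (0:ℝ), AHs lam p' q v w t) := by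
  have hp'0 : 0 < p' := hpp.symm.pos
  have hq0 : 0 < q := hpp.pos.trans_le hpq
  refine sInf_le fun f hf hf0 => ?_
  set A := ⨆ t ∈ Ioi (0:ℝ), AH lam p' q v w t with hA
  set B := ⨆ t ∈ Ioi (0:ℝ), AHs lam p' q v w t with hB
  set P : Set ℝ := Ioi 0
  have hP : MeasurableSet P := measurableSet_Ioi
  set g : ℝ → ℝ≥0∞ := P.indicator fun y => ENNReal.ofReal (f y) with hg
  set v₁ : ℝ → ℝ≥0∞ := P.indicator fun y => ENNReal.ofReal (v y) with hv₁
  set u₁ : ℝ → ℝ≥0∞ := P.indicator fun x => ENNReal.ofReal x ^ (-lam) * ENNReal.ofReal (w x)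
    with hu₁
  set v₂ : ℝ → ℝ≥0∞ := P.indicator fun y => ENNReal.ofReal y ^ (-lam) * ENNReal.ofReal (v y)
    with hv₂
  set u₂ : ℝ → ℝ≥0∞ := P.indicator fun x => ENNReal.ofReal (w x) with hu₂
  have hgm : Measurable g := Measurable.indicator (by fun_prop) hP
  have hv₁m : Measurable v₁ := Measurable.indicator (by fun_prop) hP
  have hu₁m : Measurable u₁ := Measurable.indicator (by fun_prop) hP
  have hv₂m : Measurable v₂ := Measurable.indicator (by fun_prop) hP
  have hu₂m : Measurable u₂ := Measurable.indicator (by fun_prop) hP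
  have hgp : ∫⁻ y, g y ^ p = ∫⁻ y in P, ENNReal.ofReal (f y) ^ p := by
    have := setLIntegral_indicator_rpow hP univ (fun y => ENNReal.ofReal (f y)) hpp.pos
    simpa using this
  have hinter : ∀ t : ℝ, P ∩ Iio t = Ioo 0 t := fun t => Ioi_inter_Iio
  have hempty : ∀ t : ℝ, t ≤ 0 → P ∩ Iio t = ∅ := fun t ht => by rw [hinter, Ioo_eq_empty_of_le ht]
  have hinter' : ∀ t : ℝ, 0 < t → P ∩ Ioi t = Ioi t := fun t ht =>
    inter_eq_right.2 (Ioi_subset_Ioi ht.le)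
  have hH := hardy_Iio hpp hpq hgm hv₁m hu₁m (A := A) fun t => by
    rw [setLIntegral_indicator_rpow hP _ _ hp'0, setLIntegral_indicator_rpow hP _ _ hq0]
    rcases le_or_gt t 0 with ht | ht
    · simp [hempty t ht, hp'0]
    · refine le_trans (le_of_eq ?_) (le_iSup₂ (f := fun t _ => AH lam p' q v w t) t ht)
      rw [hinter, hinter' t ht]
      simp only [AH, V0, Winf]
      simp_rw [ENNReal.mul_rpow_of_nonneg _ _ hq0.le, ← ENNReal.rpow_mul, neg_mul]
  have hHs := hardy_Ioi hpp hpq hgm hv₂m hu₂m (A := B) fun t => by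
    rw [setLIntegral_indicator_rpow hP _ _ hp'0, setLIntegral_indicator_rpow hP _ _ hq0]
    rcases le_or_gt t 0 with ht | ht
    · simp [hempty t ht, hq0]
    · refine le_trans (le_of_eq ?_) (le_iSup₂ (f := fun t _ => AHs lam p' q v w t) t ht)
      rw [hinter, hinter' t ht]
      simp only [AHs, Vinf, W0]
      simp_rw [ENNReal.mul_rpow_of_nonneg _ _ hp'0.le, ← ENNReal.rpow_mul, neg_mul]
  rw [hgp] at hH hHs
  set H₁ : ℝ → ℝ≥0∞ := fun x => u₁ x * ∫⁻ y in Iio x, g y * v₁ y with hH₁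
  set H₂ : ℝ → ℝ≥0∞ := fun x => u₂ x * ∫⁻ y in Ioi x, g y * v₂ y with hH₂
  have hH₁m : Measurable H₁ := hu₁m.mul (Monotone.measurable fun a b hab =>
    lintegral_mono_set (Iio_subset_Iio hab))
  have hH₂m : Measurable H₂ := hu₂m.mul (Antitone.measurable fun a b hab =>
    lintegral_mono_set (Ioi_subset_Ioi hab))
  have hpt : ∀ x ∈ P, ENNReal.ofReal (w x) * ∫⁻ y in P, ENNReal.ofReal (f y) * ENNReal.ofReal (v y)
      / (ENNReal.ofReal (x ^ lam) + ENNReal.ofReal (y ^ lam)) ≤ (H₁ + H₂) x := by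
    intro x hx
    set k : ℝ → ℝ≥0∞ := fun y => ENNReal.ofReal (f y) * ENNReal.ofReal (v y)
      / (ENNReal.ofReal (x ^ lam) + ENNReal.ofReal (y ^ lam)) with hk
    have hsplit : ∫⁻ y in P, k y ≤ (∫⁻ y in Iio x, P.indicator k y) + ∫⁻ y in Ioi x, k y := by
      rw [setLIntegral_indicator hP, ← setLIntegral_congr (Ioi_ae_eq_Ici (a := x)).symm]
      refine le_trans (lintegral_mono_set fun y hy => ?_) (lintegral_union_le _ _ _)
      rcases lt_or_ge y x with h | h
      · exact Or.inl ⟨hy, h⟩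
      · exact Or.inr h
    have hnear : ∫⁻ y in Iio x, P.indicator k y
        ≤ (ENNReal.ofReal (x ^ lam))⁻¹ * ∫⁻ y in Iio x, g y * v₁ y := by
      rw [← lintegral_const_mul _ (show Measurable fun y => g y * v₁ y from hgm.mul hv₁m)]
      refine lintegral_mono fun y => ?_
      by_cases hy : y ∈ P
      · simp only [hg, hv₁, hk, indicator_of_mem hy, div_eq_mul_inv]
        rw [mul_comm]
        gcongr
        exact le_self_add
      · simp [hy]
    have hfar : ∫⁻ y in Ioi x, k y ≤ ∫⁻ y in Ioi x, g y * v₂ y := by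
      refine setLIntegral_mono' measurableSet_Ioi fun y hy => ?_
      have hyP : y ∈ P := mem_Ioi.2 ((mem_Ioi.1 hx).trans hy)
      simp only [hg, hv₂, hk, indicator_of_mem hyP, div_eq_mul_inv]
      rw [ENNReal.ofReal_rpow_neg_eq_inv hyP, mul_assoc, mul_comm (ENNReal.ofReal (v y))]
      gcongr
      exact le_add_self
    calc ENNReal.ofReal (w x) * ∫⁻ y in P, k y
        ≤ ENNReal.ofReal (w x) * ((ENNReal.ofReal (x ^ lam))⁻¹ * (∫⁻ y in Iio x, g y * v₁ y)
          + ∫⁻ y in Ioi x, g y * v₂ y) :=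
          mul_le_mul_right (hsplit.trans (add_le_add hnear hfar)) _
      _ = _ := by
        simp only [Pi.add_apply, hH₁, hH₂, hu₁, hu₂, indicator_of_mem hx]
        rw [ENNReal.ofReal_rpow_neg_eq_inv hx]
        ring
  have hq1 : 0 ≤ 1/q := by positivity
  calc _ ≤ (∫⁻ x in P, (H₁ + H₂) x ^ q) ^ (1/q) :=
        ENNReal.rpow_le_rpow (setLIntegral_mono' hP fun x hx =>
          ENNReal.rpow_le_rpow (hpt x hx) hq0.le) hq1
    _ ≤ (∫⁻ x, (H₁ + H₂) x ^ q) ^ (1/q) :=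
        ENNReal.rpow_le_rpow (setLIntegral_le_lintegral _ _) hq1
    _ ≤ (∫⁻ x, H₁ x ^ q) ^ (1/q) + (∫⁻ x, H₂ x ^ q) ^ (1/q) :=
        ENNReal.lintegral_Lp_add_le hH₁m.aemeasurable hH₂m.aemeasurable (hpp.lt.le.trans hpq)
    _ ≤ _ := add_le_add hH hHs
    _ = _ := by ring

theorem stmt11 (lam p q : ℝ) (hlam : 0 < lam) (hp : 1 < p) (hpq : p ≤ q)
    (p' : ℝ) (hp' : p' = p / (p - 1)) :
    ∃ c₁ c₂ : ℝ, 0 < c₁ ∧ c₁ ≤ c₂ ∧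
      ∀ v w : ℝ → ℝ, Measurable v → Measurable w →
        (∀ y, 0 ≤ v y) → (∀ x, 0 ≤ w x) →
        LocallyIntegrableOn (fun y => v y ^ p') (Ioi (0:ℝ)) →
        LocallyIntegrableOn (fun x => w x ^ q) (Ioi (0:ℝ)) →
        ENNReal.ofReal c₁ * ((⨆ t ∈ Ioi (0:ℝ), AH lam p' q v w t)
            + ⨆ t ∈ Ioi (0:ℝ), AHs lam p' q v w t) ≤ SNorm lam p q v w
          ∧ SNorm lam p q v w ≤ ENNReal.ofReal c₂ * ((⨆ t ∈ Ioi (0:ℝ), AH lam p' q v w t)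
            + ⨆ t ∈ Ioi (0:ℝ), AHs lam p' q v w t)
          ∧ (SNorm lam p q v w < ⊤ ↔
              ((⨆ t ∈ Ioi (0:ℝ), AH lam p' q v w t)
                + ⨆ t ∈ Ioi (0:ℝ), AHs lam p' q v w t) < ⊤) := by
  have hpp : p.HolderConjugate p' := by
    rw [hp']; exact Real.HolderConjugate.conjExponent hp
  have hq0 : 0 < q := hpp.pos.trans_le hpq
  refine ⟨1/4, 8, by norm_num, by norm_num, fun v w hv hw hv0 _ _ _ => ?_⟩
  set T := (⨆ t ∈ Ioi (0:ℝ), AH lam p' q v w t) + ⨆ t ∈ Ioi (0:ℝ), AHs lam p' q v w t with hT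
  have hT4 : T ≤ 4 * SNorm lam p q v w := by
    calc T ≤ 2 * SNorm lam p q v w + 2 * SNorm lam p q v w :=
          add_le_add (iSup₂_le fun t ht => AH_le_two_mul_SNorm hlam hpp hq0 hv hw hv0 ht)
            (iSup₂_le fun t ht => AHs_le_two_mul_SNorm hlam hpp hq0 hv hw hv0 ht)
      _ = _ := by ring
  have hS8 : SNorm lam p q v w ≤ 8 * T := SNorm_le hpp hpq hv hw
  refine ⟨?_, ?_, fun h => ?_, fun h => ?_⟩
  · rw [one_div, ENNReal.ofReal_inv_of_pos (by norm_num), mul_comm, ← div_eq_mul_inv]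
    refine ENNReal.div_le_of_le_mul ?_
    rw [mul_comm]
    simpa using hT4
  · simpa using hS8
  · exact hT4.trans_lt (ENNReal.mul_lt_top (by simp) h)
  · exact hS8.trans_lt (ENNReal.mul_lt_top (by simp) h)
end
end
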